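/- Let r and s be multiplicatively independent positive integers. Then no irrational real number ξ has both a quasi-Sturmian r-ary expansion and a quasi-Sturmian s-ary expansion; equivalently, lim_{n→∞} ( p(n, ξ, r) + p(n, ξ, s) − 2n ) = +∞ for every irrational ξ. -/

import Mathlib

/-- Number of distinct factors of length `n` of the infinite word `x`. -/
noncomputable def wordComplexity {A : Type*} (x : ℕ → A) (n : ℕ) : ℕ :=
  Set.ncard {w : Fin n → A | ∃ j : ℕ, ∀ i : Fin n, w i = x (j + i)}

/-- The `(k+1)`-st digit of the `b`-ary expansion of the fractional part of `ξ`. -/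
noncomputable def bdigit (b : ℕ) (ξ : ℝ) (k : ℕ) : ℕ :=
  (⌊(b : ℝ) * Int.fract ((b : ℝ) ^ k * Int.fract ξ)⌋).toNat

/-- Positive integers `r` and `s` are multiplicatively independent. -/
def MultIndep (r s : ℕ) : Prop := ∀ m n : ℕ, r ^ m = s ^ n → m = 0 ∧ n = 0


noncomputable def padeCoef (n k a b : ℕ) : ℝ :=
  (-1) ^ a * (-1) ^ b * (k.choose a) * (k.choose b) / ((n : ℝ) * ((b : ℝ) - a) + 1)

noncomputable def padeP (n k : ℕ) (w : ℝ) : ℝ :=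
  ∑ a ∈ Finset.range (k+1), ∑ b ∈ Finset.range (k+1), padeCoef n k a b * w ^ a

noncomputable def padeQ (n k : ℕ) (w : ℝ) : ℝ :=
  ∑ a ∈ Finset.range (k+1), ∑ b ∈ Finset.range (k+1), padeCoef n k a b * w ^ b

noncomputable def padeJ (n k : ℕ) (y : ℝ) : ℝ :=
  ∫ v in y..1, (1 - (y / v) ^ n) ^ k * (1 - v ^ n) ^ k

theorem one_sub_pow_expand (x : ℝ) (k : ℕ) :
    (1 - x) ^ k = ∑ a ∈ Finset.range (k+1), (-1) ^ a * (k.choose a) * x ^ a := by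
  have := add_pow (-x) 1 k
  rw [show (1 - x) = -x + 1 by ring, this]
  refine Finset.sum_congr rfl fun a _ => ?_
  rw [neg_pow]; simp; ring

theorem pade_den_ne (n a b : ℕ) (hn : 2 ≤ n) : (n : ℤ) * ((b : ℤ) - a) ≠ -1 := by
  intro h
  have h1 : (n : ℤ) ∣ -1 := ⟨_, h.symm⟩
  have h2 : (n : ℤ) ∣ 1 := by simpa using h1
  have := Int.le_of_dvd (by norm_num) h2
  omega

theorem padeJ_eq (n k : ℕ) (hn : 2 ≤ n) (y : ℝ) (hy : 0 < y) (hy1 : y < 1) :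
    padeJ n k y = padeP n k (y ^ n) - y * padeQ n k (y ^ n) := by
  have h0 : (0 : ℝ) ∉ Set.uIcc y 1 := by
    rw [Set.uIcc_of_le hy1.le]; intro h; exact absurd h.1 (not_le.2 hy)
  have e1 : padeJ n k y = ∫ v in y..1, ∑ a ∈ Finset.range (k+1), ∑ b ∈ Finset.range (k+1),
      ((-1) ^ a * (-1) ^ b * (k.choose a) * (k.choose b) * (y^n)^a) *
        v ^ ((n : ℤ) * ((b : ℤ) - a)) := by
    unfold padeJ
    apply intervalIntegral.integral_congr
    intro v hv
    have hv0 : v ≠ 0 := fun h => h0 (h ▸ hv)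
    simp only
    rw [one_sub_pow_expand, one_sub_pow_expand, Finset.sum_mul_sum]
    refine Finset.sum_congr rfl fun a _ => Finset.sum_congr rfl fun b _ => ?_
    rw [mul_sub, zpow_sub₀ hv0, div_pow, div_pow]
    have e1 : v ^ ((n:ℤ) * (b:ℤ)) = (v ^ n) ^ b := by rw [zpow_mul]; simp
    have e2 : v ^ ((n:ℤ) * (a:ℤ)) = (v ^ n) ^ a := by rw [zpow_mul]; simp
    rw [e1, e2]
    ring
  have h_intv : ∀ m : ℤ, IntervalIntegrable (fun v : ℝ => v ^ m) MeasureTheory.volume y 1 :=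
    fun m => intervalIntegral.intervalIntegrable_zpow (Or.inr h0)
  rw [e1, intervalIntegral.integral_finsetSum]
  · unfold padeP padeQ
    rw [Finset.mul_sum, ← Finset.sum_sub_distrib]
    refine Finset.sum_congr rfl fun a _ => ?_
    rw [intervalIntegral.integral_finsetSum]
    · rw [Finset.mul_sum, ← Finset.sum_sub_distrib]
      refine Finset.sum_congr rfl fun b _ => ?_
      rw [intervalIntegral.integral_const_mul, integral_zpow (Or.inr ⟨pade_den_ne n a b hn, h0⟩)]
      unfold padeCoef
      have hd : ((n : ℝ) * ((b : ℝ) - a) + 1) ≠ 0 := by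
        have := pade_den_ne n a b hn
        intro h
        apply this
        have h' : (((n : ℤ) * ((b : ℤ) - a) : ℤ) : ℝ) = ((-1 : ℤ) : ℝ) := by push_cast; linarith
        exact_mod_cast h'
      push_cast
      rw [one_zpow, zpow_add₀ hy.ne', mul_sub, zpow_sub₀ hy.ne']
      have e1 : y ^ ((n:ℤ) * (b:ℤ)) = (y ^ n) ^ b := by rw [zpow_mul]; simp
      have e2 : y ^ ((n:ℤ) * (a:ℤ)) = (y ^ n) ^ a := by rw [zpow_mul]; simp
      rw [e1, e2]
      have : (y^n)^a ≠ 0 := by positivity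
      rw [mul_sub] at hd
      simp only [mul_sub, zpow_one]
      field_simp
    · intro b _
      exact (h_intv _).const_mul _
  · intro a _
    have h := IntervalIntegrable.sum (Finset.range (k+1)) (fun b _ =>
      (h_intv ((n : ℤ) * ((b : ℤ) - a))).const_mul
        ((-1) ^ a * (-1) ^ b * (k.choose a : ℝ) * (k.choose b) * (y^n)^a))
    rw [Finset.sum_fn] at h
    exact h

theorem padeJ_le (n k : ℕ) (y : ℝ) (hy : 0 < y) (hy1 : y < 1) :
    padeJ n k y ≤ (1 - y ^ n) ^ (2 * k) := by
  have hw : y ^ n ≤ 1 := pow_le_one₀ hy.le hy1.le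
  have := intervalIntegral.norm_integral_le_of_norm_le_const (a := y) (b := 1)
    (f := fun v : ℝ => (1 - (y / v) ^ n) ^ k * (1 - v ^ n) ^ k) (C := (1 - y ^ n) ^ (2 * k)) ?_
  · refine (le_abs_self _).trans (this.trans ?_)
    have h1 : |1 - y| ≤ 1 := by rw [abs_of_pos (by linarith)]; linarith
    have h2 : 0 ≤ (1 - y ^ n) ^ (2 * k) := by apply pow_nonneg; linarith
    nlinarith
  · intro v hv
    rw [Set.uIoc_of_le hy1.le] at hv
    have hv0 : 0 < v := hy.trans hv.1
    have a1 : (y / v) ^ n ≤ 1 := pow_le_one₀ (by positivity) ((div_le_one hv0).2 hv.1.le)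
    have a2 : v ^ n ≤ 1 := pow_le_one₀ hv0.le hv.2
    have a3 : y ^ n ≤ (y / v) ^ n := by
      apply pow_le_pow_left₀ hy.le
      rw [le_div_iff₀ hv0]; nlinarith [hv.2]
    have a4 : y ^ n ≤ v ^ n := pow_le_pow_left₀ hy.le hv.1.le n
    have b1 : 0 ≤ (1 - (y / v) ^ n) ^ k := by apply pow_nonneg; linarith
    have b2 : 0 ≤ (1 - v ^ n) ^ k := by apply pow_nonneg; linarith
    rw [Real.norm_of_nonneg (mul_nonneg b1 b2), two_mul, pow_add]
    apply mul_le_mul _ _ b2 (by apply pow_nonneg; linarith)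
    · apply pow_le_pow_left₀ <;> linarith
    · apply pow_le_pow_left₀ <;> linarith

theorem padeJ_ge (n k : ℕ) (hn : 1 ≤ n) (y : ℝ) (hy : 0 < y) (hy1 : y < 1) :
    ((1 - y ^ n) / (3 * n)) ^ (2 * k + 1) ≤ padeJ n k y := by
  have hn' : (1 : ℝ) ≤ n := by exact_mod_cast hn
  have hb : (1 - y ^ n) / (3 * n) ≤ (1 - y) / 3 := by
    have := one_add_mul_le_pow (a := y - 1) (by linarith) n
    rw [show 1 + (y - 1) = y by ring] at this
    rw [div_le_div_iff₀ (by positivity) (by norm_num)]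
    nlinarith
  have hw : y ^ n ≤ 1 := pow_le_one₀ hy.le hy1.le
  refine (pow_le_pow_left₀ (div_nonneg (by linarith) (by positivity)) hb _).trans ?_
  set c := (1 - y) / 3 with hc
  have hc0 : 0 < c := by rw [hc]; linarith
  have hcont : ContinuousOn (fun v : ℝ => (1 - (y / v) ^ n) ^ k * (1 - v ^ n) ^ k) (Set.Icc y 1) := by
    apply ContinuousOn.mul
    · apply ContinuousOn.pow
      apply ContinuousOn.sub continuousOn_const
      apply ContinuousOn.pow
      apply ContinuousOn.div continuousOn_const continuousOn_id
      intro v hv; exact (hy.trans_le hv.1).ne'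
    · fun_prop
  have hnn : ∀ v ∈ Set.Icc y 1, 0 ≤ (1 - (y / v) ^ n) ^ k * (1 - v ^ n) ^ k := by
    intro v hv
    have hv0 : 0 < v := hy.trans_le hv.1
    have a1 : (y / v) ^ n ≤ 1 := pow_le_one₀ (by positivity) ((div_le_one hv0).2 hv.1)
    have a2 : v ^ n ≤ 1 := pow_le_one₀ hv0.le hv.2
    apply mul_nonneg <;> apply pow_nonneg <;> linarith
  have hi : IntervalIntegrable (fun v : ℝ => (1 - (y / v) ^ n) ^ k * (1 - v ^ n) ^ k)
      MeasureTheory.volume y 1 := by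
    apply ContinuousOn.intervalIntegrable
    rwa [Set.uIcc_of_le hy1.le]
  have hsub : ∫ v in (y + c)..(1 - c), (1 - (y / v) ^ n) ^ k * (1 - v ^ n) ^ k ≤ padeJ n k y := by
    unfold padeJ
    apply intervalIntegral.integral_mono_interval (by linarith) (by linarith) (by linarith) _ hi
    rw [Filter.EventuallyLE, MeasureTheory.ae_restrict_iff' measurableSet_Ioc]
    exact Filter.Eventually.of_forall fun v hv => hnn v ⟨hv.1.le, hv.2⟩
  refine le_trans ?_ hsub
  have hcc : ∫ v in (y + c)..(1 - c), (c ^ (2 * k) : ℝ) = c ^ (2 * k + 1) := by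
    rw [intervalIntegral.integral_const, smul_eq_mul]
    have : 1 - c - (y + c) = c := by rw [hc]; ring
    rw [this]; ring
  rw [← hcc]
  apply intervalIntegral.integral_mono_on (by linarith)
  · simp
  · apply hi.mono_set
    rw [Set.uIcc_of_le hy1.le, Set.uIcc_of_le (by linarith)]
    exact Set.Icc_subset_Icc (by linarith) (by linarith)
  · intro v hv
    have hv0 : 0 < v := by linarith [hv.1]
    have hv1 : v ≤ 1 := by linarith [hv.2]
    have hyv : y / v ≤ 1 := (div_le_one hv0).2 (by linarith [hv.1])
    have a1 : (y / v) ^ n ≤ y / v := pow_le_of_le_one (by positivity) hyv (by omega)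
    have a2 : v ^ n ≤ v := pow_le_of_le_one (by positivity) hv1 (by omega)
    have a3 : y / v ≤ 1 - c := by
      rw [div_le_iff₀ hv0]; nlinarith [hv.1]
    rw [two_mul, pow_add]
    apply mul_le_mul _ _ (by positivity) (by apply pow_nonneg; linarith)
    · apply pow_le_pow_left₀ hc0.le; linarith
    · apply pow_le_pow_left₀ hc0.le; linarith [hv.2]

theorem pade_dvd (n k a b : ℕ) (ha : a ≤ k) (hb : b ≤ k) :
    ((n : ℤ) * ((b : ℤ) - a) + 1) ∣ (Nat.lcmUpto (n * k + 1) : ℤ) ∨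
      (n : ℤ) * ((b : ℤ) - a) + 1 = 0 := by
  by_cases h0 : (n : ℤ) * ((b : ℤ) - a) + 1 = 0
  · exact Or.inr h0
  left
  have h3 : ((n : ℤ) * ((b : ℤ) - a) + 1).natAbs ≤ n * k + 1 := by
    zify
    rw [abs_le]
    have hn : (0 : ℤ) ≤ n := by positivity
    constructor <;> nlinarith
  rw [← Int.natAbs_dvd_natAbs, Int.natAbs_natCast]
  exact Finset.dvd_lcm (f := id)
    (Finset.mem_Icc.2 ⟨Nat.one_le_iff_ne_zero.2 (Int.natAbs_ne_zero.2 h0), h3⟩)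

theorem pade_int_aux (n k a b e : ℕ) (hn : 2 ≤ n) (ha : a ≤ k) (hb : b ≤ k) (he : e ≤ k)
    (N H : ℕ) (hH : 0 < H) :
    ∃ p : ℤ, (Nat.lcmUpto (n * k + 1) : ℝ) * (H : ℝ) ^ k *
      (padeCoef n k a b * ((N : ℝ) / H) ^ e) = p := by
  have hne : (n : ℤ) * ((b : ℤ) - a) + 1 ≠ 0 := by
    have := pade_den_ne n a b hn
    omega
  obtain ⟨t, ht⟩ := (pade_dvd n k a b ha hb).resolve_right hne
  have hne' : (n : ℝ) * ((b : ℝ) - a) + 1 ≠ 0 := by exact_mod_cast hne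
  have ht' : (Nat.lcmUpto (n * k + 1) : ℝ) = ((n : ℝ) * ((b : ℝ) - a) + 1) * t := by
    exact_mod_cast ht
  refine ⟨t * (-1) ^ a * (-1) ^ b * (k.choose a) * (k.choose b) * N ^ e * H ^ (k - e), ?_⟩
  have hH' : (H : ℝ) ≠ 0 := by positivity
  rw [ht']
  unfold padeCoef
  have : (H : ℝ) ^ k = H ^ e * H ^ (k - e) := by rw [← pow_add]; congr 1; omega
  rw [this, div_pow]
  push_cast
  field_simp

theorem pade_int_sum (k : ℕ) (F : ℕ → ℕ → ℝ) (c : ℝ)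
    (h : ∀ a b, a ≤ k → b ≤ k → ∃ p : ℤ, c * F a b = p) :
    ∃ p : ℤ, c * (∑ a ∈ Finset.range (k+1), ∑ b ∈ Finset.range (k+1), F a b) = p := by
  choose! f hf using h
  refine ⟨∑ a ∈ Finset.range (k+1), ∑ b ∈ Finset.range (k+1), f a b, ?_⟩
  rw [Finset.mul_sum]
  push_cast
  refine Finset.sum_congr rfl fun a ha => ?_
  rw [Finset.mul_sum]
  refine Finset.sum_congr rfl fun b hb => ?_
  rw [Finset.mem_range] at ha hb
  exact hf a b (by omega) (by omega)

theorem padeQ_abs_le (n k : ℕ) (hn : 2 ≤ n) (w : ℝ) (hw : 0 ≤ w) (hw1 : w ≤ 1) :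
    |padeQ n k w| ≤ 4 ^ k := by
  have h4 : ∑ a ∈ Finset.range (k+1), ∑ b ∈ Finset.range (k+1),
      ((k.choose a : ℝ) * (k.choose b)) = 4 ^ k := by
    rw [← Finset.sum_mul_sum]
    have := Nat.sum_range_choose k
    have h2 : ∑ a ∈ Finset.range (k+1), (k.choose a : ℝ) = 2 ^ k := by exact_mod_cast this
    rw [h2, ← mul_pow]; norm_num
  rw [← h4]
  unfold padeQ
  refine (Finset.abs_sum_le_sum_abs _ _).trans (Finset.sum_le_sum fun a _ => ?_)
  refine (Finset.abs_sum_le_sum_abs _ _).trans (Finset.sum_le_sum fun b _ => ?_)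
  have hne : (n : ℤ) * ((b : ℤ) - a) + 1 ≠ 0 := by
    have := pade_den_ne n a b hn
    omega
  have h1 : (1 : ℝ) ≤ |(n : ℝ) * ((b : ℝ) - a) + 1| := by
    have := Int.one_le_abs hne
    exact_mod_cast this
  unfold padeCoef
  rw [abs_mul, abs_div, abs_mul, abs_mul, abs_mul, abs_pow, abs_pow, abs_neg, abs_one,
    one_pow, one_pow, one_mul, one_mul, abs_of_nonneg (by positivity : (0:ℝ) ≤ (k.choose a : ℝ)),
    abs_of_nonneg (by positivity : (0:ℝ) ≤ (k.choose b : ℝ)), abs_of_nonneg (pow_nonneg hw b)]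
  have h2 : w ^ b ≤ 1 := pow_le_one₀ hw hw1
  have h3 : (0 : ℝ) ≤ (k.choose a : ℝ) * (k.choose b) := by positivity
  have h5 : (k.choose a : ℝ) * (k.choose b) / |(n : ℝ) * ((b : ℝ) - a) + 1| ≤
    (k.choose a : ℝ) * (k.choose b) := div_le_self h3 h1
  calc _ ≤ (k.choose a : ℝ) * (k.choose b) * 1 :=
        mul_le_mul h5 h2 (pow_nonneg hw b) h3
    _ = _ := mul_one _

theorem lcmUpto_le_pow (n k : ℕ) (hk : 1 ≤ k) :
    (Nat.lcmUpto (n * k + 1) : ℝ) ≤ (Real.exp ((Real.log 4 + 4) * (n + 1))) ^ k := by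
  have h1 := Chebyshev.psi_le_const_mul_self (x := ((n * k + 1 : ℕ) : ℝ)) (by positivity)
  rw [Chebyshev.psi_eq_log_lcmUpto] at h1
  have hp : (0 : ℝ) < (Nat.lcmUpto (n * k + 1) : ℝ) := by
    exact_mod_cast Nat.lcmUpto_pos _
  rw [← Real.exp_nat_mul, ← Real.log_le_iff_le_exp hp]
  refine h1.trans ?_
  have hk' : (1 : ℝ) ≤ k := by exact_mod_cast hk
  have hl : 0 ≤ Real.log 4 + 4 := by
    have := Real.log_nonneg (show (1:ℝ) ≤ 4 by norm_num); linarith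
  push_cast
  have : (n : ℝ) * k + 1 ≤ k * (n + 1) := by nlinarith
  calc _ ≤ (Real.log 4 + 4) * (k * (n + 1)) := mul_le_mul_of_nonneg_left this hl
    _ = _ := by ring

/-- The Padé-type approximations to `(N/H)^(1/n)`. -/
theorem pade_main (n : ℕ) (hn : 2 ≤ n) : ∃ C : ℝ, 1 ≤ C ∧ ∀ k : ℕ, 1 ≤ k → ∀ (N H : ℕ) (y : ℝ),
    0 < y → y < 1 → 0 < H → y ^ n = (N : ℝ) / H →
    ∃ p q : ℤ, (H : ℝ) ^ k * ((1 - (N : ℝ) / H) / (3 * n)) ^ (2 * k + 1) ≤ p - q * y ∧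
      p - q * y ≤ C ^ k * H ^ k * (1 - (N : ℝ) / H) ^ (2 * k) ∧ |(q : ℝ)| ≤ C ^ k * H ^ k := by
  set E := Real.exp ((Real.log 4 + 4) * (n + 1)) with hE
  have hl : 0 ≤ (Real.log 4 + 4) * (n + 1) := by
    have := Real.log_nonneg (show (1:ℝ) ≤ 4 by norm_num); positivity
  have hE1 : 1 ≤ E := Real.one_le_exp hl
  refine ⟨4 * E, by linarith, ?_⟩
  intro k hk N H y hy hy1 hH hw
  obtain ⟨p, hp⟩ := pade_int_sum k (fun a b => padeCoef n k a b * ((N : ℝ) / H) ^ a)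
    ((Nat.lcmUpto (n * k + 1) : ℝ) * (H : ℝ) ^ k)
    (fun a b ha hb => pade_int_aux n k a b a hn ha hb ha N H hH)
  obtain ⟨q, hq⟩ := pade_int_sum k (fun a b => padeCoef n k a b * ((N : ℝ) / H) ^ b)
    ((Nat.lcmUpto (n * k + 1) : ℝ) * (H : ℝ) ^ k)
    (fun a b ha hb => pade_int_aux n k a b b hn ha hb hb N H hH)
  change _ * padeP n k ((N : ℝ) / H) = _ at hp
  change _ * padeQ n k ((N : ℝ) / H) = _ at hq
  set D := (Nat.lcmUpto (n * k + 1) : ℝ) with hD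
  have hD1 : 1 ≤ D := by
    rw [hD]; exact_mod_cast Nat.lcmUpto_pos _
  have hDE : D ≤ E ^ k := lcmUpto_le_pow n k hk
  have hJ := padeJ_eq n k hn y hy hy1
  have hL : (p : ℝ) - q * y = D * H ^ k * padeJ n k y := by
    rw [hJ, hw, ← hp, ← hq]; ring
  have hle := padeJ_le n k y hy hy1
  have hge := padeJ_ge n k (by omega) y hy hy1
  rw [hw] at hle hge
  have hHk : (0 : ℝ) < (H : ℝ) ^ k := by positivity
  have hw0 : 0 ≤ (N : ℝ) / H := by positivity
  have hw1 : (N : ℝ) / H ≤ 1 := by rw [← hw]; exact pow_le_one₀ hy.le hy1.le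
  have hE4 : E ^ k ≤ (4 * E) ^ k := pow_le_pow_left₀ (by linarith) (by linarith) k
  have hJ0 : 0 ≤ padeJ n k y := by
    refine le_trans ?_ hge
    apply pow_nonneg; apply div_nonneg <;> [linarith; positivity]
  refine ⟨p, q, ?_, ?_, ?_⟩
  · rw [hL]
    calc _ ≤ (H : ℝ) ^ k * padeJ n k y := mul_le_mul_of_nonneg_left hge hHk.le
      _ = 1 * ((H : ℝ) ^ k * padeJ n k y) := (one_mul _).symm
      _ ≤ D * ((H : ℝ) ^ k * padeJ n k y) := mul_le_mul_of_nonneg_right hD1 (by positivity)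
      _ = _ := by ring
  · rw [hL]
    apply mul_le_mul _ hle hJ0 (by positivity)
    exact mul_le_mul_of_nonneg_right (hDE.trans hE4) hHk.le
  · rw [← hq, abs_mul, abs_mul, abs_of_pos (by linarith : 0 < D), abs_of_pos hHk, mul_pow]
    have := padeQ_abs_le n k hn _ hw0 hw1
    calc D * H ^ k * |padeQ n k ((N : ℝ) / H)| ≤ (E ^ k * H ^ k) * 4 ^ k :=
          mul_le_mul (mul_le_mul_of_nonneg_right hDE hHk.le) this (abs_nonneg _) (by positivity)
      _ = _ := by ring

theorem thue_zero (lc h g : ℝ) (k K : ℕ) (hh : 0 < h)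
    (hlc : lc ≤ h / 100) (hl2 : Real.log 4 ≤ h / 100) (hk5 : 5 ≤ k) (hkK : k ≤ K) (hK3 : K ≤ 3 * k)
    (hg1 : 6 * k * h ≤ g) (hg2 : g ≤ 6 * (k + 1) * h)
    (X0 Y0 X Y : ℕ) (y y1 : ℝ) (p q : ℤ)
    (hX0 : (X0 : ℝ) ≤ Real.exp h) (hY0 : (Y0 : ℝ) ≤ Real.exp h)
    (hX : (X : ℝ) ≤ Real.exp (g / 20)) (hY : (Y : ℝ) ≤ Real.exp (g / 20))
    (hyy : X0 * Y * y = Y0 * X * y1) (hy1 : |y1 - 1| ≤ Real.exp (- (7 * g / 8)))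
    (hL0 : 0 ≤ p - q * y) (hL : p - q * y ≤ Real.exp (K * lc + K * h + 2 * K * (-(7 * h / 8))))
    (hq : |(q : ℝ)| ≤ Real.exp (K * lc + K * h)) :
    p * (X0 * Y) = q * (Y0 * X) := by
  have hk5' : (5 : ℝ) ≤ k := by exact_mod_cast hk5
  have hkK' : (k : ℝ) ≤ K := by exact_mod_cast hkK
  have hK3' : (K : ℝ) ≤ 3 * k := by exact_mod_cast hK3
  have h5h : 5 * h ≤ k * h := mul_le_mul_of_nonneg_right hk5' hh.le
  have hKh : k * h ≤ K * h := mul_le_mul_of_nonneg_right hkK' hh.le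
  have hKh3 : K * h ≤ 3 * k * h := mul_le_mul_of_nonneg_right hK3' hh.le
  have hKlc : K * lc ≤ K * (h / 100) := mul_le_mul_of_nonneg_left hlc (by linarith)
  have key : (p * (X0 * Y) - q * (Y0 * X) : ℝ) =
      X0 * Y * (p - q * y) + q * (Y0 * X) * (y1 - 1) := by
    linear_combination (q : ℝ) * hyy
  have b1 : X0 * Y * (p - q * y) ≤ 1 / 4 := by
    calc X0 * Y * (p - q * y) ≤ Real.exp h * Real.exp (g / 20) *
          Real.exp (K * lc + K * h + 2 * K * (-(7 * h / 8))) := by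
          apply mul_le_mul _ hL hL0 (by positivity)
          apply mul_le_mul hX0 hY (by positivity) (by positivity)
      _ = Real.exp (h + g / 20 + (K * lc + K * h + 2 * K * (-(7 * h / 8)))) := by
          rw [← Real.exp_add, ← Real.exp_add]
      _ ≤ Real.exp (- Real.log 4) := by
          apply Real.exp_le_exp.2
          linarith
      _ = 1 / 4 := by rw [Real.exp_neg, Real.exp_log (by norm_num)]; norm_num
  have b0 : 0 ≤ X0 * Y * (p - q * y) := by positivity
  have b2 : |q * (Y0 * X) * (y1 - 1)| ≤ 1 / 4 := by
    rw [abs_mul, abs_mul, abs_of_nonneg (by positivity : (0:ℝ) ≤ (Y0 : ℝ) * X)]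
    calc |(q : ℝ)| * (Y0 * X) * |y1 - 1| ≤ Real.exp (K * lc + K * h) *
          (Real.exp h * Real.exp (g / 20)) * Real.exp (- (7 * g / 8)) := by
          apply mul_le_mul _ hy1 (by positivity) (by positivity)
          apply mul_le_mul hq _ (by positivity) (by positivity)
          apply mul_le_mul hY0 hX (by positivity) (by positivity)
      _ = Real.exp (K * lc + K * h + (h + g / 20) + -(7 * g / 8)) := by
          rw [← Real.exp_add, ← Real.exp_add, ← Real.exp_add]
      _ ≤ Real.exp (- Real.log 4) := by
          apply Real.exp_le_exp.2
          linarith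
      _ = 1 / 4 := by rw [Real.exp_neg, Real.exp_log (by norm_num)]; norm_num
  have hlt : |((p * (X0 * Y) - q * (Y0 * X) : ℤ) : ℝ)| < 1 := by
    push_cast
    rw [key]
    rw [abs_le] at b2
    rw [abs_lt]
    constructor <;> linarith [b2.1, b2.2]
  have : |p * (X0 * Y) - q * (Y0 * X)| < 1 := by exact_mod_cast hlt
  have := Int.abs_lt_one_iff.1 this
  linarith

theorem thue_contra (lc h l : ℝ) (k : ℕ) (hh : 0 < h) (h60 : Real.log 60 ≤ h / 100)
    (hlc : lc ≤ h / 100) (hk5 : 5 ≤ k) (hl : l ≤ -(7 * h / 8)) (y : ℝ) (τ : ℝ)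
    (p q p' q' : ℤ) (h1 : (p : ℝ) = q * τ) (h2 : (p' : ℝ) = q' * τ)
    (hL : Real.exp (k * h + (2 * k + 1) * (l - Real.log 60)) ≤ p - q * y)
    (hq : |(q : ℝ)| ≤ Real.exp (k * lc + k * h))
    (hL'0 : 0 < p' - q' * y)
    (hL' : p' - q' * y ≤ Real.exp (3 * k * lc + 3 * k * h + 6 * k * l)) : False := by
  have hk5' : (5 : ℝ) ≤ k := by exact_mod_cast hk5
  have hq' : q' ≠ 0 := by
    rintro rfl
    rw [h2] at hL'0
    simp at hL'0
  have hq'1 : (1 : ℝ) ≤ |(q' : ℝ)| := by exact_mod_cast Int.one_le_abs hq'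
  have a1 : |τ - y| ≤ p' - q' * y := by
    have : (p' : ℝ) - q' * y = |(q' : ℝ)| * |τ - y| := by
      rw [← abs_mul, ← abs_of_pos hL'0, h2]; congr 1; ring
    rw [this]
    nlinarith [abs_nonneg (τ - y)]
  have a2 : (p : ℝ) - q * y ≤ |(q : ℝ)| * |τ - y| := by
    rw [← abs_mul]
    refine le_trans (le_of_eq ?_) (le_abs_self _)
    rw [h1]; ring
  have a3 : (p : ℝ) - q * y ≤ Real.exp (k * lc + k * h) *
      Real.exp (3 * k * lc + 3 * k * h + 6 * k * l) :=
    a2.trans (mul_le_mul hq (a1.trans hL') (abs_nonneg _) (by positivity))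
  rw [← Real.exp_add] at a3
  have a4 := Real.exp_le_exp.1 (hL.trans a3)
  have h5h : 5 * h ≤ k * h := mul_le_mul_of_nonneg_right hk5' hh.le
  have hKlc : k * lc ≤ k * (h / 100) := mul_le_mul_of_nonneg_left hlc (by linarith)
  have hK60 : k * Real.log 60 ≤ k * (h / 100) := mul_le_mul_of_nonneg_left h60 (by linarith)
  have hkl : (4 * k - 1) * l ≤ (4 * k - 1) * (-(7 * h / 8)) :=
    mul_le_mul_of_nonneg_left hl (by linarith)
  nlinarith

theorem thue_facts (A B X Y : ℕ) (hG : 2 ≤ A * X ^ 20) (hB : 0 < B)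
    (hlt : B * Y ^ 20 < A * X ^ 20)
    (he : (A * X ^ 20 - B * Y ^ 20) ^ 8 ≤ A * X ^ 20) (g : ℝ)
    (hg : g = Real.log ((A * X ^ 20 : ℕ) : ℝ)) :
    ∃ y : ℝ, 0 < y ∧ y < 1 ∧ y ^ 20 = ((B * Y ^ 20 : ℕ) : ℝ) / ((A * X ^ 20 : ℕ) : ℝ) ∧
      |y - 1| ≤ Real.exp (-(7 * g / 8)) ∧ (X : ℝ) ≤ Real.exp (g / 20) ∧
      (Y : ℝ) ≤ Real.exp (g / 20) ∧
      0 < 1 - ((B * Y ^ 20 : ℕ) : ℝ) / ((A * X ^ 20 : ℕ) : ℝ) ∧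
      1 - ((B * Y ^ 20 : ℕ) : ℝ) / ((A * X ^ 20 : ℕ) : ℝ) ≤ Real.exp (-(7 * g / 8)) := by
  have hA : 0 < A := by
    rcases Nat.eq_zero_or_pos A with h | h
    · subst h; simp at hG
    · exact h
  have hX20 : X ^ 20 ≤ A * X ^ 20 := Nat.le_mul_of_pos_left _ hA
  have hY20 : Y ^ 20 ≤ A * X ^ 20 := (Nat.le_mul_of_pos_left _ hB).trans hlt.le
  have hN : 0 < B * Y ^ 20 := by
    rcases Nat.eq_zero_or_pos (B * Y ^ 20) with h | h
    · rw [h, Nat.sub_zero] at he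
      have := Nat.pow_lt_pow_right (a := A * X ^ 20) (by omega) (show 1 < 8 by norm_num)
      rw [pow_one] at this
      omega
    · exact h
  generalize hNN : B * Y ^ 20 = N at *
  generalize hGG : A * X ^ 20 = G at *
  have hG0 : (0 : ℝ) < G := by exact_mod_cast (by omega : 0 < G)
  have hN0 : (0 : ℝ) < N := by exact_mod_cast hN
  have hexp : Real.exp g = G := by rw [hg, Real.exp_log hG0]
  have hx20 : ∀ Z : ℕ, Z ^ 20 ≤ G → (Z : ℝ) ≤ Real.exp (g / 20) := by
    intro Z hZ
    apply le_of_pow_le_pow_left₀ (n := 20) (by norm_num) (by positivity)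
    rw [← Real.exp_nat_mul]
    have : ((20 : ℕ) : ℝ) * (g / 20) = g := by push_cast; ring
    rw [this, hexp]
    exact_mod_cast hZ
  have hw1 : (N : ℝ) / G < 1 := by
    rw [div_lt_one hG0]; exact_mod_cast hlt
  have hw0 : 0 < (N : ℝ) / G := by positivity
  have hz : 1 - (N : ℝ) / G ≤ Real.exp (-(7 * g / 8)) := by
    have e1 : ((G - N : ℕ) : ℝ) ≤ Real.exp (g / 8) := by
      apply le_of_pow_le_pow_left₀ (n := 8) (by norm_num) (by positivity)
      rw [← Real.exp_nat_mul]
      have : ((8 : ℕ) : ℝ) * (g / 8) = g := by push_cast; ring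
      rw [this, hexp]
      exact_mod_cast he
    rw [Nat.cast_sub hlt.le] at e1
    have : 1 - (N : ℝ) / G = (G - N) / G := by field_simp
    rw [this, div_le_iff₀ hG0]
    refine e1.trans (le_of_eq ?_)
    rw [← hexp, ← Real.exp_add]; congr 1; ring
  set y := ((N : ℝ) / G) ^ ((1 : ℝ) / 20) with hy
  have hy0 : 0 < y := Real.rpow_pos_of_pos hw0 _
  have hyp : y ^ 20 = (N : ℝ) / G := by
    rw [hy, ← Real.rpow_natCast, ← Real.rpow_mul hw0.le]; norm_num
  have hy1 : y < 1 := Real.rpow_lt_one hw0.le hw1 (by norm_num)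
  refine ⟨y, hy0, hy1, hyp, ?_, hx20 X hX20, hx20 Y hY20, by linarith, hz⟩
  rw [abs_sub_comm, abs_of_pos (by linarith)]
  have : y ^ 20 ≤ y := pow_le_of_le_one hy0.le hy1.le (by norm_num)
  linarith

theorem thue (A B : ℕ) (hA : 0 < A) (hB : 0 < B) : ∃ N0 : ℕ, ∀ X Y : ℕ, N0 ≤ X →
    B * Y ^ 20 < A * X ^ 20 → (A * X ^ 20 - B * Y ^ 20) ^ 8 ≤ A * X ^ 20 → False := by
  by_contra hcon
  push Not at hcon
  obtain ⟨C, hC1, hC⟩ := pade_main 20 (by norm_num)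
  have hbig : ∀ R : ℝ, ∃ X Y : ℕ, 2 ≤ A * X ^ 20 ∧ R ≤ Real.log ((A * X ^ 20 : ℕ) : ℝ) ∧
      B * Y ^ 20 < A * X ^ 20 ∧ (A * X ^ 20 - B * Y ^ 20) ^ 8 ≤ A * X ^ 20 := by
    intro R
    obtain ⟨X, Y, h1, h2, h3, -⟩ := hcon (⌈Real.exp R⌉₊ + 2)
    have hX : X ≤ A * X ^ 20 :=
      (Nat.le_self_pow (by norm_num) X).trans (Nat.le_mul_of_pos_left _ hA)
    refine ⟨X, Y, by omega, ?_, h2, h3⟩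
    rw [Real.le_log_iff_exp_le (by exact_mod_cast (by omega))]
    refine (Nat.le_ceil _).trans ?_
    exact_mod_cast (by omega)
  set lc := Real.log C with hlcdef
  have hlc0 : 0 ≤ lc := Real.log_nonneg hC1
  have hCexp : Real.exp lc = C := Real.exp_log (by linarith)
  have hl60 : 0 < Real.log 60 := Real.log_pos (by norm_num)
  have hl4 : 0 < Real.log 4 := Real.log_pos (by norm_num)
  obtain ⟨X0, Y0, hH2, hHR, hlt0, he0⟩ := hbig (100 * lc + 100 * Real.log 60 + 100 * Real.log 4 + 1)
  set h := Real.log ((A * X0 ^ 20 : ℕ) : ℝ) with hh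
  have hh0 : 0 < h := by linarith
  obtain ⟨y, hy0, hy1, hyp, -, hX0, hY0, hz0, hz⟩ := thue_facts A B X0 Y0 hH2 hB hlt0 he0 h hh
  obtain ⟨X, Y, hG2, hGR, hlt, he⟩ := hbig (30 * h)
  set g := Real.log ((A * X ^ 20 : ℕ) : ℝ) with hg
  obtain ⟨y1, hy10, hy11, hy1p, hy1e, hX, hY, -, -⟩ := thue_facts A B X Y hG2 hB hlt he g hg
  have hXpos : 0 < X := by
    rcases Nat.eq_zero_or_pos X with h | h
    · subst h; simp at hG2
    · exact h
  have hX0pos : 0 < X0 := by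
    rcases Nat.eq_zero_or_pos X0 with h | h
    · subst h; simp at hH2
    · exact h
  have hYpos : 0 < Y := by
    rcases Nat.eq_zero_or_pos Y with h | h
    · subst h
      simp only [Nat.cast_mul, Nat.cast_pow] at hy1p
      norm_num at hy1p
      exact absurd hy1p hy10.ne'
    · exact h
  have hyy : X0 * Y * y = Y0 * X * y1 := by
    rw [← pow_left_inj₀ (n := 20) (by positivity) (by positivity) (by norm_num),
      mul_pow, mul_pow, mul_pow, mul_pow, hyp, hy1p]
    push_cast
    field_simp
  set k := ⌊g / (6 * h)⌋₊ with hk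
  have hgh : 5 ≤ g / (6 * h) := by rw [le_div_iff₀ (by positivity)]; linarith
  have hk5 : 5 ≤ k := Nat.le_floor (by exact_mod_cast hgh)
  have hg1 : 6 * k * h ≤ g := by
    have := Nat.floor_le (show 0 ≤ g / (6 * h) by linarith)
    rw [← hk, le_div_iff₀ (by positivity)] at this
    linarith
  have hg2 : g ≤ 6 * (k + 1) * h := by
    have := Nat.lt_floor_add_one (g / (6 * h))
    rw [← hk, div_lt_iff₀ (by positivity)] at this
    linarith
  have hHpos : (0 : ℝ) < ((A * X0 ^ 20 : ℕ) : ℝ) := by exact_mod_cast (by omega)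
  have hHexp : Real.exp h = ((A * X0 ^ 20 : ℕ) : ℝ) := Real.exp_log hHpos
  set z := 1 - ((B * Y0 ^ 20 : ℕ) : ℝ) / ((A * X0 ^ 20 : ℕ) : ℝ) with hzdef
  set l := Real.log z with hl
  have hlexp : Real.exp l = z := Real.exp_log hz0
  have hlz : l ≤ -(7 * h / 8) := by
    rw [← Real.exp_le_exp, hlexp]; exact hz
  have h60exp : Real.exp (Real.log 60) = 60 := Real.exp_log (by norm_num)
  have hpade : ∀ K : ℕ, 1 ≤ K → ∃ p q : ℤ,
      Real.exp (K * h + (2 * K + 1) * (l - Real.log 60)) ≤ p - q * y ∧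
      p - q * y ≤ Real.exp (K * lc + K * h + 2 * K * l) ∧
      |(q : ℝ)| ≤ Real.exp (K * lc + K * h) := by
    intro K hK
    obtain ⟨p, q, h1, h2, h3⟩ := hC K hK (B * Y0 ^ 20) (A * X0 ^ 20) y hy0 hy1 (by omega) hyp
    refine ⟨p, q, ?_, ?_, ?_⟩
    · refine le_trans (le_of_eq ?_) h1
      rw [Real.exp_add, Real.exp_nat_mul, hHexp]
      have : (2 * (K : ℝ) + 1) = ((2 * K + 1 : ℕ) : ℝ) := by push_cast; ring
      rw [this, Real.exp_nat_mul, Real.exp_sub, hlexp, h60exp,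
        show (3 * ((20 : ℕ) : ℝ)) = 60 by norm_num]
    · refine h2.trans (le_of_eq ?_)
      rw [Real.exp_add, Real.exp_add, Real.exp_nat_mul, Real.exp_nat_mul, hHexp, hCexp]
      have : (2 * (K : ℝ)) = ((2 * K : ℕ) : ℝ) := by push_cast; ring
      rw [this, Real.exp_nat_mul, hlexp]
    · refine h3.trans (le_of_eq ?_)
      rw [Real.exp_add, Real.exp_nat_mul, Real.exp_nat_mul, hHexp, hCexp]
  have hX0' : (X0 : ℝ) ≤ Real.exp h := hX0.trans (Real.exp_le_exp.2 (by linarith))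
  have hY0' : (Y0 : ℝ) ≤ Real.exp h := hY0.trans (Real.exp_le_exp.2 (by linarith))
  have hzero : ∀ K : ℕ, k ≤ K → K ≤ 3 * k → ∀ p q : ℤ, 
      Real.exp (K * h + (2 * K + 1) * (l - Real.log 60)) ≤ p - q * y →
      p - q * y ≤ Real.exp (K * lc + K * h + 2 * K * l) →
      |(q : ℝ)| ≤ Real.exp (K * lc + K * h) →
      (p : ℝ) = q * ((Y0 * X) / (X0 * Y)) := by
    intro K hkK hK3 p q h1 h2 h3
    have := thue_zero lc h g k K hh0 (by linarith) (by linarith) hk5 hkK hK3 hg1 hg2 X0 Y0 X Y y y1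
      p q hX0' hY0' hX hY hyy hy1e ((Real.exp_pos _).le.trans h1)
      (h2.trans (Real.exp_le_exp.2 (by
        have : 2 * (K : ℝ) * l ≤ 2 * K * (-(7 * h / 8)) :=
          mul_le_mul_of_nonneg_left hlz (by positivity)
        linarith))) h3
    have h5 : (p : ℝ) * (X0 * Y) = q * (Y0 * X) := by exact_mod_cast this
    have : (0 : ℝ) < X0 * Y := by positivity
    field_simp
    linarith
  obtain ⟨p, q, h1, h2, h3⟩ := hpade k (by omega)
  obtain ⟨p', q', h1', h2', h3'⟩ := hpade (3 * k) (by omega)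
  have t1 := hzero k le_rfl (by omega) p q h1 h2 h3
  have t2 := hzero (3 * k) (by omega) le_rfl p' q' h1' h2' h3'
  refine thue_contra lc h l k hh0 (by linarith) (by linarith) hk5 hlz y _ p q p' q' t1 t2 h1 h3
    ((Real.exp_pos _).trans_le h1') (h2'.trans (le_of_eq ?_))
  congr 1
  push_cast
  ring

theorem val_bound (q b : ℕ) (hq : q.Prime) (hb : 2 ≤ b) :
    ∃ C : ℕ, ∀ p : ℕ, 1 ≤ p → padicValNat q (b ^ p - 1) ≤ C + Nat.log 2 p := by
  haveI : Fact q.Prime := ⟨hq⟩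
  have hlog : ∀ p, padicValNat q p ≤ Nat.log 2 p := fun p =>
    (padicValNat_le_nat_log p).trans (Nat.log_anti_left (by norm_num) hq.two_le)
  have hpos : ∀ p, 1 ≤ p → 2 ≤ b ^ p := fun p hp =>
    hb.trans (Nat.le_self_pow (by omega) b)
  by_cases hqb : q ∣ b
  · refine ⟨0, fun p hp => ?_⟩
    have : ¬ q ∣ b ^ p - 1 := by
      intro h
      have h1 : q ∣ b ^ p := dvd_pow hqb (by omega)
      have h2 := (Nat.dvd_sub_iff_right (by have := hpos p hp; omega) h1).1 h
      exact hq.one_lt.ne' (Nat.dvd_one.1 h2)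
    rw [padicValNat.eq_zero_of_not_dvd this]
    omega
  have hdv : ∀ p m, 1 ≤ p → 1 ≤ m → padicValNat q (b ^ p - 1) ≤ padicValNat q (b ^ (m * p) - 1) := by
    intro p m hp hm
    have h1 : b ^ p - 1 ∣ b ^ (m * p) - 1 := by
      have := Nat.sub_dvd_pow_sub_pow (b ^ p) 1 m
      rwa [one_pow, ← pow_mul, mul_comm] at this
    have h2 : b ^ (m * p) - 1 ≠ 0 := by
      have := hpos (m * p) (Nat.mul_pos hm hp); omega
    rw [← padicValNat_dvd_iff_le h2]
    exact pow_padicValNat_dvd.trans h1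
  rcases hq.eq_two_or_odd' with h2 | hodd
  · subst h2
    refine ⟨padicValNat 2 (b + 1) + padicValNat 2 (b - 1) + 1, fun p hp => ?_⟩
    refine (hdv p 2 hp (by norm_num)).trans ?_
    have h1 := padicValNat.pow_two_sub_pow (x := b) (y := 1) (by omega) (by omega) hqb
      (n := 2 * p) (by omega) (even_two_mul p)
    rw [one_pow, padicValNat.mul (by norm_num) (by omega), padicValNat.self (by norm_num)] at h1
    have := hlog p
    omega
  · refine ⟨padicValNat q (b ^ (q - 1) - 1), fun p hp => ?_⟩
    have hq1 : 1 ≤ q - 1 := by have := hq.two_le; omega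
    refine (hdv p (q - 1) hp hq1).trans ?_
    have hx : ¬ q ∣ b ^ (q - 1) := fun h => hqb (hq.dvd_of_dvd_pow h)
    have hf : q ∣ b ^ (q - 1) - 1 := by
      have := Nat.ModEq.pow_totient ((Nat.Prime.coprime_iff_not_dvd hq).2 hqb).symm
      rw [Nat.totient_prime hq] at this
      exact (Nat.modEq_iff_dvd' (by have := hpos _ hq1; omega)).1 this.symm
    have h1 := padicValNat.pow_sub_pow (p := q) (x := b ^ (q - 1)) (y := 1) hodd
      (by have := hpos _ hq1; omega) hf hx (n := p) (by omega)
    rw [one_pow, ← pow_mul] at h1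
    have := hlog p
    omega

theorem pow_sub_fac (r i j : ℕ) (hij : i < j) : r ^ j - r ^ i = r ^ i * (r ^ (j - i) - 1) := by
  rw [Nat.mul_sub, mul_one, ← pow_add]; congr 2; omega

theorem val_lin (q r s K : ℕ) (hq : q.Prime) (hr : 2 ≤ r) (hs : 2 ≤ s) :
    ∃ C : ℕ, ∀ i j i' j' c c' : ℕ, i < j → i' < j' → 1 ≤ c → c ≤ K → 1 ≤ c' → c' ≤ K →
      c * (r ^ j - r ^ i) = c' * (s ^ j' - s ^ i') →
      i * padicValNat q r ≤ i' * padicValNat q s + C + Nat.log 2 j' := by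
  haveI : Fact q.Prime := ⟨hq⟩
  obtain ⟨C, hC⟩ := val_bound q s hq hs
  refine ⟨C + K, ?_⟩
  intro i j i' j' c c' hij hij' hc hcK hc' hcK' heq
  rw [pow_sub_fac r i j hij, pow_sub_fac s i' j' hij'] at heq
  have n1 : r ^ i ≠ 0 := by positivity
  have n2 : s ^ i' ≠ 0 := by positivity
  have n3 : r ^ (j - i) - 1 ≠ 0 := by
    have : 2 ≤ r ^ (j - i) := hr.trans (Nat.le_self_pow (by omega) r)
    omega
  have n4 : s ^ (j' - i') - 1 ≠ 0 := by
    have : 2 ≤ s ^ (j' - i') := hs.trans (Nat.le_self_pow (by omega) s)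
    omega
  have h := congrArg (padicValNat q) heq
  rw [padicValNat.mul (by omega) (mul_ne_zero n1 n3), padicValNat.mul n1 n3,
    padicValNat.mul (by omega) (mul_ne_zero n2 n4), padicValNat.mul n2 n4,
    padicValNat.pow, padicValNat.pow] at h
  have h1 := hC (j' - i') (by omega)
  have h2 : Nat.log 2 (j' - i') ≤ Nat.log 2 j' := Nat.log_mono_right (by omega)
  have h3 : padicValNat q c' ≤ K := by
    refine (padicValNat_le_nat_log c').trans ?_
    exact (Nat.log_le_self q c').trans hcK'
  omega

theorem exists_det (r s : ℕ) (hr : 2 ≤ r) (hs : 2 ≤ s) (hind : MultIndep r s) :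
    ∃ q1 q2 : ℕ, q1.Prime ∧ q2.Prime ∧
      padicValNat q1 r * padicValNat q2 s ≠ padicValNat q2 r * padicValNat q1 s := by
  by_contra hcon
  push Not at hcon
  obtain ⟨q1, hq1, hq1r⟩ := Nat.exists_prime_and_dvd (n := r) (by omega)
  haveI : Fact q1.Prime := ⟨hq1⟩
  have hv : 1 ≤ padicValNat q1 r := one_le_padicValNat_of_dvd (by omega) hq1r
  have : r ^ (padicValNat q1 s) = s ^ (padicValNat q1 r) := by
    apply Nat.eq_of_factorization_eq (by positivity) (by positivity)
    intro q
    by_cases hq : q.Prime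
    · rw [Nat.factorization_pow, Nat.factorization_pow]
      simp only [Finsupp.smul_apply, smul_eq_mul]
      rw [Nat.factorization_def _ hq, Nat.factorization_def _ hq]
      have := hcon q1 q hq1 hq
      linarith
    · rw [Nat.factorization_eq_zero_of_not_prime _ hq, Nat.factorization_eq_zero_of_not_prime _ hq]
  have := (hind _ _ this).2
  omega

theorem i_bound (r s K : ℕ) (hr : 2 ≤ r) (hs : 2 ≤ s) (hind : MultIndep r s) :
    ∃ C : ℕ, ∀ i j i' j' c c' : ℕ, i < j → i' < j' → 1 ≤ c → c ≤ K → 1 ≤ c' → c' ≤ K →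
      c * (r ^ j - r ^ i) = c' * (s ^ j' - s ^ i') →
      i ≤ C * (C + Nat.log 2 j + Nat.log 2 j') := by
  obtain ⟨q1, q2, hq1, hq2, hdet⟩ := exists_det r s hr hs hind
  obtain ⟨C1, h1⟩ := val_lin q1 r s K hq1 hr hs
  obtain ⟨C2, h2⟩ := val_lin q2 r s K hq2 hr hs
  obtain ⟨C3, h3⟩ := val_lin q1 s r K hq1 hs hr
  obtain ⟨C4, h4⟩ := val_lin q2 s r K hq2 hs hr
  refine ⟨C1 + C2 + C3 + C4 + padicValNat q1 s + padicValNat q2 s, ?_⟩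
  intro i j i' j' c c' hij hij' hc hcK hc' hcK' heq
  have e1 := h1 i j i' j' c c' hij hij' hc hcK hc' hcK' heq
  have e2 := h2 i j i' j' c c' hij hij' hc hcK hc' hcK' heq
  have e3 := h3 i' j' i j c' c hij' hij hc' hcK' hc hcK heq.symm
  have e4 := h4 i' j' i j c' c hij' hij hc' hcK' hc hcK heq.symm
  generalize padicValNat q1 r = a1 at *
  generalize padicValNat q2 r = a2 at *
  generalize padicValNat q1 s = b1 at *
  generalize padicValNat q2 s = b2 at *
  generalize Nat.log 2 j = l at *
  generalize Nat.log 2 j' = l' at *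
  set T : ℤ := C1 + C2 + C3 + C4 + l + l' with hT
  have hd : (a1 : ℤ) * b2 - a2 * b1 ≠ 0 := by
    intro h; apply hdet; zify; linarith
  have hd1 : 1 ≤ |(a1 : ℤ) * b2 - a2 * b1| := Int.one_le_abs hd
  zify at e1 e2 e3 e4
  have f1 : |(i : ℤ) * a1 - i' * b1| ≤ T := by rw [abs_le]; constructor <;> omega
  have f2 : |(i : ℤ) * a2 - i' * b2| ≤ T := by rw [abs_le]; constructor <;> omega
  have key : (i : ℤ) * (a1 * b2 - a2 * b1) =
      (i * a1 - i' * b1) * b2 - (i * a2 - i' * b2) * b1 := by ring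
  have k2 : (i : ℤ) ≤ |(i : ℤ) * (a1 * b2 - a2 * b1)| := by
    rw [abs_mul, abs_of_nonneg (by positivity : (0 : ℤ) ≤ i)]
    have : (0 : ℤ) ≤ i := by positivity
    nlinarith
  have k3 : |(i : ℤ) * (a1 * b2 - a2 * b1)| ≤ T * b2 + T * b1 := by
    rw [key]
    refine (abs_sub _ _).trans ?_
    rw [abs_mul, abs_mul, abs_of_nonneg (by positivity : (0 : ℤ) ≤ b2),
      abs_of_nonneg (by positivity : (0 : ℤ) ≤ b1)]
    have : (0 : ℤ) ≤ b1 := by positivity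
    have : (0 : ℤ) ≤ b2 := by positivity
    nlinarith
  have k4 : T * b2 + T * b1 ≤ ((C1 + C2 + C3 + C4 + b1 + b2 : ℕ) : ℤ) *
      ((C1 + C2 + C3 + C4 + b1 + b2 : ℕ) + l + l') := by
    have e : T * b2 + T * b1 = (b1 + b2) * T := by ring
    rw [e]
    apply mul_le_mul
    · push_cast; omega
    · push_cast; omega
    · omega
    · positivity
  zify
  push_cast at *
  linarith

theorem lin_le_two_pow (a b L : ℕ) (hL : 2 * (2 * a + b) ≤ L) : a * L + b ≤ 2 ^ L := by
  have h1 : L / 2 + 1 ≤ 2 ^ (L / 2) := Nat.lt_two_pow_self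
  have h2 : (2 ^ (L / 2)) * (2 ^ (L / 2)) ≤ 2 ^ L := by
    rw [← pow_add]; exact Nat.pow_le_pow_right (by norm_num) (by omega)
  have h3 : L ≤ 2 * (L / 2) + 1 := by omega
  have h4 : 2 * a + b ≤ L / 2 := by omega
  generalize L / 2 = t at *
  have h5 := Nat.mul_le_mul h1 h1
  nlinarith

theorem j_bound (r s K : ℕ) (hr : 2 ≤ r) (hs : 2 ≤ s) (i j i' j' c c' : ℕ)
    (hij' : i' < j') (hcK : c ≤ K) (hc' : 1 ≤ c')
    (heq : c * (r ^ j - r ^ i) = c' * (s ^ j' - s ^ i')) : j' ≤ 1 + K + r * j := by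
  have h1 : 2 ^ (j' - 1) ≤ s ^ j' - s ^ i' := by
    have e1 : s ^ i' ≤ s ^ (j' - 1) := Nat.pow_le_pow_right (by omega) (by omega)
    have e2 : s ^ j' = s ^ (j' - 1) * s := by rw [← pow_succ]; congr 1; omega
    have e3 : 2 ^ (j' - 1) ≤ s ^ (j' - 1) := Nat.pow_le_pow_left hs _
    have e4 : s ^ (j' - 1) * 2 ≤ s ^ (j' - 1) * s := Nat.mul_le_mul_left _ hs
    omega
  have h2 : s ^ j' - s ^ i' ≤ c' * (s ^ j' - s ^ i') := Nat.le_mul_of_pos_left _ hc'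
  have h3 : c * (r ^ j - r ^ i) ≤ K * r ^ j := Nat.mul_le_mul hcK (Nat.sub_le _ _)
  have h4 : K * r ^ j ≤ 2 ^ K * (2 ^ r) ^ j :=
    Nat.mul_le_mul Nat.lt_two_pow_self.le (Nat.pow_le_pow_left Nat.lt_two_pow_self.le _)
  have h5 : 2 ^ (j' - 1) ≤ 2 ^ (K + r * j) := by
    rw [pow_add, pow_mul]; omega
  have := (Nat.pow_le_pow_iff_right (by norm_num)).1 h5
  omega

theorem i_small (r s K : ℕ) (hr : 2 ≤ r) (hs : 2 ≤ s) (hind : MultIndep r s) :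
    ∃ N : ℕ, ∀ i j i' j' c c' : ℕ, i < j → i' < j' → 1 ≤ c → c ≤ K → 1 ≤ c' → c' ≤ K →
      c * (r ^ j - r ^ i) = c' * (s ^ j' - s ^ i') → N ≤ j → 8 * K + 8 * i ≤ j := by
  obtain ⟨C, hC⟩ := i_bound r s K hr hs hind
  set E := 1 + K + r with hE
  set a := 8 * (C * 2) with ha
  set b := 8 * K + 8 * (C * (C + E + 1)) with hb
  refine ⟨2 ^ (2 * (2 * a + b)), ?_⟩
  intro i j i' j' c c' hij hij' hc hcK hc' hcK' heq hN
  have h1 := hC i j i' j' c c' hij hij' hc hcK hc' hcK' heq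
  have h2 := j_bound r s K hr hs i j i' j' c c' hij' hcK hc' heq
  have hj : j ≠ 0 := by omega
  set L := Nat.log 2 j with hL
  have hLj : 2 ^ L ≤ j := Nat.pow_log_le_self 2 hj
  have hjL : j < 2 ^ (L + 1) := Nat.lt_pow_succ_log_self (by norm_num) j
  have hL' : Nat.log 2 j' ≤ E + L + 1 := by
    rw [← Nat.log_pow (b := 2) (by norm_num) (E + L + 1)]
    apply Nat.log_mono_right
    have : j' ≤ E * j := by
      have : 1 ≤ j := by omega
      rw [hE]; nlinarith
    refine this.trans ?_
    rw [add_assoc, pow_add]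
    exact Nat.mul_le_mul Nat.lt_two_pow_self.le hjL.le
  have hbig : 2 * (2 * a + b) ≤ L := by
    rw [hL]; exact Nat.le_log_of_pow_le (by norm_num) hN
  have h5 := lin_le_two_pow a b L hbig
  have h6 : C * (C + L + Nat.log 2 j') ≤ C * (C + L + (E + L + 1)) :=
    Nat.mul_le_mul_left _ (by omega)
  have h7 : 8 * K + 8 * (C * (C + L + (E + L + 1))) = a * L + b := by rw [ha, hb]; ring
  omega

theorem unit_eq_one (r s K : ℕ) (hr : 2 ≤ r) (hs : 2 ≤ s) (hind : MultIndep r s) :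
    ∃ N : ℕ, ∀ i j i' j' c c' : ℕ, i < j → i' < j' → 1 ≤ c → c ≤ K → 1 ≤ c' → c' ≤ K →
      c * (r ^ j - r ^ i) = c' * (s ^ j' - s ^ i') → c' * s ^ j' < c * r ^ j → N ≤ j → False := by
  obtain ⟨N1, hN1⟩ := i_small r s K hr hs hind
  have hth : ∀ c c' ρ σ : ℕ, ∃ N0 : ℕ, 1 ≤ c → 1 ≤ c' → ∀ X Y : ℕ, N0 ≤ X →
      (c' * s ^ σ) * Y ^ 20 < (c * r ^ ρ) * X ^ 20 →
      ((c * r ^ ρ) * X ^ 20 - (c' * s ^ σ) * Y ^ 20) ^ 8 ≤ (c * r ^ ρ) * X ^ 20 → False := by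
    intro c c' ρ σ
    by_cases h : 1 ≤ c ∧ 1 ≤ c'
    · obtain ⟨N0, h0⟩ := thue (c * r ^ ρ) (c' * s ^ σ) (Nat.mul_pos h.1 (by positivity))
        (Nat.mul_pos h.2 (by positivity))
      exact ⟨N0, fun _ _ => h0⟩
    · exact ⟨0, fun h1 h2 => absurd ⟨h1, h2⟩ h⟩
  choose F hF using hth
  set N2 := (Finset.range (K + 1)).sup fun c => (Finset.range (K + 1)).sup fun c' =>
    (Finset.range 20).sup fun ρ => (Finset.range 20).sup fun σ => F c c' ρ σ with hN2
  have hFle : ∀ c c' ρ σ, c ≤ K → c' ≤ K → ρ < 20 → σ < 20 → F c c' ρ σ ≤ N2 := by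
    intro c c' ρ σ h1 h2 h3 h4
    rw [hN2]
    refine le_trans ?_ (Finset.le_sup (f := fun c => (Finset.range (K + 1)).sup fun c' =>
      (Finset.range 20).sup fun ρ => (Finset.range 20).sup fun σ => F c c' ρ σ)
      (Finset.mem_range.2 (Nat.lt_succ_of_le h1)))
    refine le_trans ?_ (Finset.le_sup (f := fun c' =>
      (Finset.range 20).sup fun ρ => (Finset.range 20).sup fun σ => F c c' ρ σ)
      (Finset.mem_range.2 (Nat.lt_succ_of_le h2)))
    refine le_trans ?_ (Finset.le_sup (f := fun ρ => (Finset.range 20).sup fun σ => F c c' ρ σ)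
      (Finset.mem_range.2 h3))
    exact Finset.le_sup (f := fun σ => F c c' ρ σ) (Finset.mem_range.2 h4)
  refine ⟨N1 + 20 * N2 + 20, ?_⟩
  intro i j i' j' c c' hij hij' hc hcK hc' hcK' heq hlt hN
  have hi := hN1 i j i' j' c c' hij hij' hc hcK hc' hcK' heq (by omega)
  have e1 : (c * r ^ (j % 20)) * (r ^ (j / 20)) ^ 20 = c * r ^ j := by
    rw [mul_assoc, ← pow_mul, ← pow_add]; congr 2; omega
  have e2 : (c' * s ^ (j' % 20)) * (s ^ (j' / 20)) ^ 20 = c' * s ^ j' := by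
    rw [mul_assoc, ← pow_mul, ← pow_add]; congr 2; omega
  have hFX : F c c' (j % 20) (j' % 20) ≤ r ^ (j / 20) := by
    refine (hFle c c' _ _ hcK hcK' (Nat.mod_lt _ (by norm_num)) (Nat.mod_lt _ (by norm_num))).trans ?_
    have h1 : j / 20 < r ^ (j / 20) := Nat.lt_pow_self (by omega)
    omega
  refine hF c c' (j % 20) (j' % 20) hc hc' (r ^ (j / 20)) (s ^ (j' / 20)) hFX ?_ ?_
  · rw [e1, e2]; exact hlt
  · rw [e1, e2]
    have hri : r ^ i ≤ r ^ j := Nat.pow_le_pow_right (by omega) hij.le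
    have hle : c * r ^ j - c' * s ^ j' ≤ K * r ^ i := by
      rw [Nat.mul_sub, Nat.mul_sub] at heq
      have h1 : c * r ^ i ≤ K * r ^ i := Nat.mul_le_mul_right _ hcK
      have h2 : c' * s ^ i' ≤ c' * s ^ j' :=
        Nat.mul_le_mul_left _ (Nat.pow_le_pow_right (by omega) hij'.le)
      have h3 : c * r ^ i ≤ c * r ^ j := Nat.mul_le_mul_left _ hri
      omega
    calc (c * r ^ j - c' * s ^ j') ^ 8 ≤ (K * r ^ i) ^ 8 := Nat.pow_le_pow_left hle _
      _ ≤ (r ^ K * r ^ i) ^ 8 := by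
          apply Nat.pow_le_pow_left
          exact Nat.mul_le_mul_right _ (Nat.lt_pow_self (by omega)).le
      _ = r ^ (8 * K + 8 * i) := by rw [← pow_add, ← pow_mul]; congr 1; ring
      _ ≤ r ^ j := Nat.pow_le_pow_right (by omega) hi
      _ ≤ c * r ^ j := Nat.le_mul_of_pos_left _ hc

theorem MultIndep.symm' {r s : ℕ} (h : MultIndep r s) : MultIndep s r :=
  fun m n hmn => (h n m hmn.symm).symm

theorem unit_eq (r s K : ℕ) (hr : 2 ≤ r) (hs : 2 ≤ s) (hind : MultIndep r s) :
    ∃ N : ℕ, ∀ i j i' j' c c' : ℕ, i < j → i' < j' → 1 ≤ c → c ≤ K → 1 ≤ c' → c' ≤ K →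
      c * (r ^ j - r ^ i) = c' * (s ^ j' - s ^ i') → N ≤ j → False := by
  obtain ⟨N1, h1⟩ := unit_eq_one r s K hr hs hind
  obtain ⟨N2, h2⟩ := unit_eq_one s r K hs hr hind.symm'
  refine ⟨N1 + (2 + K + s * N2), ?_⟩
  intro i j i' j' c c' hij hij' hc hcK hc' hcK' heq hN
  rcases lt_trichotomy (c' * s ^ j') (c * r ^ j) with h | h | h
  · exact h1 i j i' j' c c' hij hij' hc hcK hc' hcK' heq h (by omega)
  · have heq' := heq
    rw [Nat.mul_sub, Nat.mul_sub] at heq'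
    have f1 : c * r ^ i ≤ c * r ^ j :=
      Nat.mul_le_mul_left _ (Nat.pow_le_pow_right (by omega) hij.le)
    have f2 : c' * s ^ i' ≤ c' * s ^ j' :=
      Nat.mul_le_mul_left _ (Nat.pow_le_pow_right (by omega) hij'.le)
    have f3 : c * r ^ i = c' * s ^ i' := by omega
    have f4 : r ^ (j - i) = s ^ (j' - i') := by
      have e1 : c * r ^ j = c * r ^ i * r ^ (j - i) := by
        rw [mul_assoc, ← pow_add]; congr 2; omega
      have e2 : c' * s ^ j' = c' * s ^ i' * s ^ (j' - i') := by
        rw [mul_assoc, ← pow_add]; congr 2; omega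
      rw [e1, e2, ← f3] at h
      have : 0 < c * r ^ i := by positivity
      exact (Nat.eq_of_mul_eq_mul_left this h).symm
    have := (hind _ _ f4).1
    omega
  · refine h2 i' j' i j c' c hij' hij hc' hcK' hc hcK heq.symm h ?_
    by_contra hlt
    have := j_bound s r K hs hr i' j' i j c' c hij hcK' hc heq.symm
    have : s * j' ≤ s * N2 := Nat.mul_le_mul_left _ (by omega)
    omega

noncomputable def tailf (b : ℕ) (ξ : ℝ) (k : ℕ) : ℝ := Int.fract ((b : ℝ) ^ k * Int.fract ξ)

theorem tailf_step (b : ℕ) (ξ : ℝ) (k : ℕ) :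
    (b : ℝ) * tailf b ξ k = bdigit b ξ k + tailf b ξ (k + 1) := by
  have h0 : (0 : ℝ) ≤ (b : ℝ) * tailf b ξ k := mul_nonneg (by positivity) (Int.fract_nonneg _)
  have h1 : ((bdigit b ξ k : ℕ) : ℝ) = (⌊(b : ℝ) * tailf b ξ k⌋ : ℝ) := by
    have : ((bdigit b ξ k : ℕ) : ℤ) = ⌊(b : ℝ) * tailf b ξ k⌋ :=
      Int.toNat_of_nonneg (Int.floor_nonneg.2 h0)
    exact_mod_cast this
  have h2 : tailf b ξ (k + 1) = Int.fract ((b : ℝ) * tailf b ξ k) := by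
    unfold tailf
    rw [Int.fract_eq_fract]
    refine ⟨b * ⌊(b : ℝ) ^ k * Int.fract ξ⌋, ?_⟩
    have := Int.self_sub_floor ((b : ℝ) ^ k * Int.fract ξ)
    rw [← this]; push_cast; ring
  rw [h1, h2]
  exact (Int.floor_add_fract _).symm

theorem bdigit_lt (b : ℕ) (hb : 0 < b) (ξ : ℝ) (k : ℕ) : bdigit b ξ k < b := by
  have h := tailf_step b ξ k
  have h1 : tailf b ξ k < 1 := Int.fract_lt_one _
  have h2 : 0 ≤ tailf b ξ (k + 1) := Int.fract_nonneg _
  have hb' : (0 : ℝ) < b := by exact_mod_cast hb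
  have : ((bdigit b ξ k : ℕ) : ℝ) < b := by nlinarith
  exact_mod_cast this

theorem tailf_close (b : ℕ) (hb : 0 < b) (ξ : ℝ) (n : ℕ) : ∀ i j : ℕ,
    (∀ m, m < n → bdigit b ξ (i + m) = bdigit b ξ (j + m)) →
    |tailf b ξ j - tailf b ξ i| * (b : ℝ) ^ n < 1 := by
  induction n with
  | zero =>
    intro i j _
    have h1 : tailf b ξ i < 1 := Int.fract_lt_one _
    have h2 : 0 ≤ tailf b ξ i := Int.fract_nonneg _
    have h3 : tailf b ξ j < 1 := Int.fract_lt_one _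
    have h4 : 0 ≤ tailf b ξ j := Int.fract_nonneg _
    rw [pow_zero, mul_one, abs_lt]
    constructor <;> linarith
  | succ n ih =>
    intro i j h
    have h1 := ih (i + 1) (j + 1) (fun m hm => by
      have := h (m + 1) (by omega)
      rw [show i + 1 + m = i + (m + 1) by ring, show j + 1 + m = j + (m + 1) by ring]
      exact this)
    have e0 : bdigit b ξ i = bdigit b ξ j := h 0 (by omega)
    have e1 := tailf_step b ξ i
    have e2 := tailf_step b ξ j
    rw [e0] at e1
    have e3 : tailf b ξ (j + 1) - tailf b ξ (i + 1) = b * (tailf b ξ j - tailf b ξ i) := by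
      linarith
    rw [e3, abs_mul, abs_of_nonneg (by positivity : (0 : ℝ) ≤ b)] at h1
    calc _ = (b : ℝ) * |tailf b ξ j - tailf b ξ i| * (b : ℝ) ^ n := by rw [pow_succ]; ring
      _ < 1 := h1

theorem tailf_diff (b : ℕ) (ξ : ℝ) (i j : ℕ) : ∃ P : ℤ,
    tailf b ξ j - tailf b ξ i = ((b : ℝ) ^ j - (b : ℝ) ^ i) * ξ - P := by
  refine ⟨((b : ℤ) ^ j - (b : ℤ) ^ i) * ⌊ξ⌋ + ⌊(b : ℝ) ^ j * Int.fract ξ⌋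
    - ⌊(b : ℝ) ^ i * Int.fract ξ⌋, ?_⟩
  have h1 := Int.self_sub_floor ((b : ℝ) ^ j * Int.fract ξ)
  have h2 := Int.self_sub_floor ((b : ℝ) ^ i * Int.fract ξ)
  have h3 := Int.self_sub_floor ξ
  unfold tailf
  rw [← h1, ← h2, ← h3]; push_cast; ring

/-- windows of a word -/
def win {A : Type*} (x : ℕ → A) (n i : ℕ) : Fin n → A := fun m => x (i + m)

theorem wordComplexity_eq {A : Type*} (x : ℕ → A) (n : ℕ) :
    wordComplexity x n = (Set.range (win x n)).ncard := by
  unfold wordComplexity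
  congr 1
  ext w
  simp only [Set.mem_setOf_eq, Set.mem_range]
  constructor
  · rintro ⟨j, hj⟩; exact ⟨j, by ext1 i; exact (hj i).symm⟩
  · rintro ⟨j, rfl⟩; exact ⟨j, fun i => rfl⟩

theorem range_win_finite (x : ℕ → ℕ) (b : ℕ) (hx : ∀ k, x k < b) (n : ℕ) :
    (Set.range (win x n)).Finite := by
  refine (Set.Finite.pi' (t := fun _ : Fin n => Set.Iio b) fun _ => Set.finite_Iio b).subset ?_
  rintro _ ⟨j, rfl⟩ i
  exact hx _

theorem morse_hedlund (x : ℕ → ℕ) (b : ℕ) (hx : ∀ k, x k < b) (n : ℕ)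
    (h : wordComplexity x (n + 1) ≤ wordComplexity x n) :
    ∃ i j, i < j ∧ ∀ m, x (i + m) = x (j + m) := by
  rw [wordComplexity_eq, wordComplexity_eq] at h
  set ρ : (Fin (n + 1) → ℕ) → (Fin n → ℕ) := fun w i => w i.castSucc with hρ
  have hρw : ∀ i, ρ (win x (n + 1) i) = win x n i := fun i => rfl
  have him : Set.image ρ (Set.range (win x (n + 1))) = Set.range (win x n) := by
    rw [← Set.range_comp]; rfl
  have hfin := range_win_finite x b hx
  have hinj : Set.InjOn ρ (Set.range (win x (n + 1))) := by
    apply Set.injOn_of_ncard_image_eq _ (hfin _)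
    apply le_antisymm (Set.ncard_image_le (hfin _))
    rw [him]; exact h
  have hstep : ∀ i j, win x n i = win x n j → win x (n + 1) i = win x (n + 1) j := by
    intro i j hij
    exact hinj ⟨i, rfl⟩ ⟨j, rfl⟩ (by rw [hρw, hρw, hij])
  have hshift : ∀ i j, win x n i = win x n j → win x n (i + 1) = win x n (j + 1) := by
    intro i j hij
    ext1 m
    have := congrFun (hstep i j hij) m.succ
    simp only [win, Fin.val_succ] at this ⊢
    rw [show i + 1 + (m : ℕ) = i + (m + 1) by ring, show j + 1 + (m : ℕ) = j + (m + 1) by ring]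
    exact this
  have hall : ∀ i j, win x n i = win x n j → ∀ m, win x n (i + m) = win x n (j + m) := by
    intro i j hij m
    induction m with
    | zero => exact hij
    | succ m ih => exact hshift _ _ ih
  obtain ⟨i, -, j, -, hne, hij⟩ := Set.infinite_univ.exists_ne_map_eq_of_mapsTo
    (f := win x n) (t := Set.range (win x n)) (fun i _ => ⟨i, rfl⟩) (hfin n)
  have fin : ∀ i j, win x n i = win x n j → ∀ m, x (i + m) = x (j + m) := by
    intro i j hij m
    have := congrFun (hstep _ _ (hall i j hij m)) 0
    simpa [win] using this
  rcases lt_or_gt_of_ne hne with h | h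
  · exact ⟨i, j, h, fin i j hij⟩
  · exact ⟨j, i, h, fin j i hij.symm⟩

theorem irr_ne (ξ : ℝ) (hξ : Irrational ξ) (q P : ℤ) (h : (q : ℝ) * ξ = P) : q = 0 := by
  by_contra hq
  apply hξ
  refine ⟨(P : ℚ) / q, ?_⟩
  push_cast
  rw [← h]
  have : (q : ℝ) ≠ 0 := by exact_mod_cast hq
  field_simp

theorem complexity_step (b : ℕ) (hb : 2 ≤ b) (ξ : ℝ) (hξ : Irrational ξ) (n : ℕ) :
    wordComplexity (bdigit b ξ) n + 1 ≤ wordComplexity (bdigit b ξ) (n + 1) := by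
  by_contra hcon
  obtain ⟨i, j, hij, h⟩ := morse_hedlund (bdigit b ξ) b (bdigit_lt b (by omega) ξ) n (by omega)
  have hcl : ∀ n, |tailf b ξ j - tailf b ξ i| * (b : ℝ) ^ n < 1 := fun n =>
    tailf_close b (by omega) ξ n i j (fun m _ => h m)
  have hz : tailf b ξ j - tailf b ξ i = 0 := by
    by_contra hne
    have hpos : 0 < |tailf b ξ j - tailf b ξ i| := abs_pos.2 hne
    obtain ⟨n, hn⟩ := pow_unbounded_of_one_lt (|tailf b ξ j - tailf b ξ i|)⁻¹
      (by exact_mod_cast (by omega : 1 < b) : (1 : ℝ) < b)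
    have := hcl n
    rw [inv_lt_iff_one_lt_mul₀ hpos] at hn
    linarith
  obtain ⟨P, hP⟩ := tailf_diff b ξ i j
  have := irr_ne ξ hξ ((b : ℤ) ^ j - (b : ℤ) ^ i) P (by push_cast; linarith)
  have h2 : (b : ℤ) ^ i < (b : ℤ) ^ j := pow_lt_pow_right₀ (by exact_mod_cast (by omega : 1 < b)) hij
  omega

theorem complexity_mono (b : ℕ) (hb : 2 ≤ b) (ξ : ℝ) (hξ : Irrational ξ) (n m : ℕ) :
    wordComplexity (bdigit b ξ) n + m ≤ wordComplexity (bdigit b ξ) (n + m) := by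
  induction m with
  | zero => simp
  | succ m ih => have := complexity_step b hb ξ hξ (n + m); rw [← add_assoc, ← add_assoc]; omega

def Good (b k : ℕ) (ξ : ℝ) : Prop := ∀ n : ℕ, ∃ i j : ℕ, ∃ P : ℤ, i < j ∧ j ≤ n + k ∧
  |((b : ℝ) ^ j - (b : ℝ) ^ i) * ξ - P| * (b : ℝ) ^ n < 1

theorem good_of_complexity (b k : ℕ) (hb : 2 ≤ b) (ξ : ℝ)
    (h : ∀ n, wordComplexity (bdigit b ξ) n ≤ n + k) : Good b k ξ := by
  intro n
  have hfin := range_win_finite (bdigit b ξ) b (bdigit_lt b (by omega) ξ) n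
  have hn := h n
  rw [wordComplexity_eq] at hn
  have key : ∃ i j, i < j ∧ j ≤ n + k ∧ win (bdigit b ξ) n i = win (bdigit b ξ) n j := by
    have : hfin.toFinset.card < (Finset.range (n + k + 1)).card := by
      rw [Finset.card_range, ← Set.ncard_eq_toFinset_card _ hfin]; omega
    obtain ⟨i, hi, j, hj, hne, hij⟩ := Finset.exists_ne_map_eq_of_card_lt_of_maps_to this
      (f := win (bdigit b ξ) n) (fun i _ => by simp)
    rw [Finset.mem_range] at hi hj
    rcases lt_or_gt_of_ne hne with h | h
    · exact ⟨i, j, h, by omega, hij⟩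
    · exact ⟨j, i, h, by omega, hij.symm⟩
  obtain ⟨i, j, hij, hj, hw⟩ := key
  obtain ⟨P, hP⟩ := tailf_diff b ξ i j
  refine ⟨i, j, P, hij, hj, ?_⟩
  rw [← hP]
  exact tailf_close b (by omega) ξ n i j (fun m hm => congrFun hw ⟨m, hm⟩)

theorem good_or_tendsto (r s : ℕ) (hr : 2 ≤ r) (hs : 2 ≤ s) (ξ : ℝ) (hξ : Irrational ξ)
    (H : ∀ k, Good r k ξ → Good s k ξ → False) :
    Filter.Tendsto
      (fun n : ℕ => (wordComplexity (bdigit r ξ) n : ℤ)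
        + (wordComplexity (bdigit s ξ) n : ℤ) - 2 * n)
      Filter.atTop Filter.atTop := by
  rw [Filter.tendsto_atTop]
  intro M
  have h0 : ∃ n0 : ℕ, M ≤ (wordComplexity (bdigit r ξ) n0 : ℤ)
        + (wordComplexity (bdigit s ξ) n0 : ℤ) - 2 * n0 := by
    by_contra hcon
    push Not at hcon
    have a1 := complexity_mono r hr ξ hξ 0
    have a2 := complexity_mono s hs ξ hξ 0
    refine H M.toNat (good_of_complexity r _ hr ξ fun n => ?_)
      (good_of_complexity s _ hs ξ fun n => ?_) <;>
    · have b1 := a1 n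
      have b2 := a2 n
      have b3 := hcon n
      rw [zero_add] at b1 b2
      omega
  obtain ⟨n0, h0⟩ := h0
  filter_upwards [Filter.eventually_ge_atTop n0] with n hn
  have a1 := complexity_mono r hr ξ hξ n0 (n - n0)
  have a2 := complexity_mono s hs ξ hξ n0 (n - n0)
  rw [Nat.add_sub_cancel' hn] at a1 a2
  omega

theorem det_bound (ξ : ℝ) (Q1 Q2 P1 P2 : ℤ) (w1 w2 A C : ℝ) (hQ1 : 0 ≤ Q1) (hQ2 : 0 ≤ Q2)
    (hA : 0 ≤ A) (hC : 0 ≤ C) (e1 : |(Q1 : ℝ) * ξ - P1| * w1 < 1)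
    (e2 : |(Q2 : ℝ) * ξ - P2| * w2 < 1) (h1 : (Q1 : ℝ) ≤ A * w2) (h2 : (Q2 : ℝ) ≤ C * w1) :
    |((Q1 * P2 - Q2 * P1 : ℤ) : ℝ)| ≤ A + C := by
  have hQ1' : (0 : ℝ) ≤ Q1 := by exact_mod_cast hQ1
  have hQ2' : (0 : ℝ) ≤ Q2 := by exact_mod_cast hQ2
  have key : ((Q1 * P2 - Q2 * P1 : ℤ) : ℝ) = Q2 * (Q1 * ξ - P1) - Q1 * (Q2 * ξ - P2) := by
    push_cast; ring
  rw [key]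
  refine (abs_sub _ _).trans ?_
  rw [abs_mul, abs_mul, abs_of_nonneg hQ1', abs_of_nonneg hQ2']
  have a1 : (Q2 : ℝ) * |(Q1 : ℝ) * ξ - P1| ≤ C := by
    calc (Q2 : ℝ) * |(Q1 : ℝ) * ξ - P1| ≤ (C * w1) * |(Q1 : ℝ) * ξ - P1| :=
          mul_le_mul_of_nonneg_right h2 (abs_nonneg _)
      _ = C * (|(Q1 : ℝ) * ξ - P1| * w1) := by ring
      _ ≤ C * 1 := mul_le_mul_of_nonneg_left e1.le hC
      _ = C := mul_one C
  have a2 : (Q1 : ℝ) * |(Q2 : ℝ) * ξ - P2| ≤ A := by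
    calc (Q1 : ℝ) * |(Q2 : ℝ) * ξ - P2| ≤ (A * w2) * |(Q2 : ℝ) * ξ - P2| :=
          mul_le_mul_of_nonneg_right h1 (abs_nonneg _)
      _ = A * (|(Q2 : ℝ) * ξ - P2| * w2) := by ring
      _ ≤ A * 1 := mul_le_mul_of_nonneg_left e2.le hA
      _ = A := mul_one A
  linarith

theorem irr_dist (b : ℕ) (hb : 2 ≤ b) (ξ : ℝ) (hξ : Irrational ξ) (B : ℕ) :
    ∃ n0 : ℕ, ∀ q P : ℤ, q ≠ 0 → |q| ≤ B → ∀ n, n0 ≤ n →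
      1 ≤ |(q : ℝ) * ξ - P| * (b : ℝ) ^ n := by
  set D : ℝ := (B.factorial : ℝ) * ξ with hD
  have hε : 0 < |D - round D| := by
    rw [abs_pos]
    intro h
    have := irr_ne ξ hξ (B.factorial : ℤ) (round D) (by push_cast; linarith)
    have := B.factorial_pos
    omega
  have hb1 : (1 : ℝ) < b := by exact_mod_cast (by omega : 1 < b)
  obtain ⟨n0, hn0⟩ := pow_unbounded_of_one_lt ((B.factorial : ℝ) * |D - round D|⁻¹) hb1
  refine ⟨n0, ?_⟩
  intro q P hq hqB n hn
  have hdvd : q ∣ (B.factorial : ℤ) := by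
    rw [← Int.natAbs_dvd_natAbs, Int.natAbs_natCast]
    exact Nat.dvd_factorial (Int.natAbs_pos.2 hq) (by rw [Int.abs_eq_natAbs] at hqB; omega)
  obtain ⟨t, ht⟩ := hdvd
  have hfp : (0 : ℝ) < B.factorial := by exact_mod_cast B.factorial_pos
  have ht1 : |(t : ℝ)| ≤ B.factorial := by
    have : |t| ≤ (B.factorial : ℤ) := by
      rw [ht]
      rw [← abs_of_nonneg (a := q * t) (by rw [← ht]; positivity), abs_mul]
      have := Int.one_le_abs hq
      have := abs_nonneg t
      nlinarith
    exact_mod_cast this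
  have h1 : |D - round D| ≤ |D - (t * P : ℤ)| := round_le D _
  have h2 : D - (t * P : ℤ) = t * ((q : ℝ) * ξ - P) := by
    have : (B.factorial : ℝ) = q * t := by exact_mod_cast ht
    rw [hD, this]; push_cast; ring
  rw [h2, abs_mul] at h1
  have h3 : |D - round D| ≤ B.factorial * |(q : ℝ) * ξ - P| :=
    h1.trans (mul_le_mul_of_nonneg_right ht1 (abs_nonneg _))
  have h4 : (b : ℝ) ^ n0 ≤ (b : ℝ) ^ n := pow_le_pow_right₀ hb1.le hn
  have h5 : (B.factorial : ℝ) < |D - round D| * (b : ℝ) ^ n := by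
    have : (B.factorial : ℝ) * |D - round D|⁻¹ < (b : ℝ) ^ n := hn0.trans_le h4
    rw [← div_eq_mul_inv, div_lt_iff₀ hε] at this
    linarith
  have h6 : |D - round D| * (b : ℝ) ^ n ≤ B.factorial * |(q : ℝ) * ξ - P| * (b : ℝ) ^ n :=
    mul_le_mul_of_nonneg_right h3 (by positivity)
  by_contra hcon
  push Not at hcon
  nlinarith

/-- denominators -/
def qq (b i j : ℕ) : ℤ := (b : ℤ) ^ j - (b : ℤ) ^ i

def App (b : ℕ) (ξ : ℝ) (n i j : ℕ) (P : ℤ) : Prop :=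
  i < j ∧ |(qq b i j : ℝ) * ξ - P| * (b : ℝ) ^ n < 1

def MinApp (b : ℕ) (ξ : ℝ) (n i j : ℕ) (P : ℤ) : Prop :=
  App b ξ n i j P ∧ ∀ i1 j1 P1, App b ξ n i1 j1 P1 → j ≤ j1

theorem Good.app {b k : ℕ} {ξ : ℝ} (h : Good b k ξ) (n : ℕ) :
    ∃ i j P, App b ξ n i j P ∧ j ≤ n + k := by
  obtain ⟨i, j, P, h1, h2, h3⟩ := h n
  refine ⟨i, j, P, ⟨h1, ?_⟩, h2⟩
  unfold qq; push_cast; exact h3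

theorem Good.minApp {b k : ℕ} {ξ : ℝ} (h : Good b k ξ) (n : ℕ) :
    ∃ i j P, MinApp b ξ n i j P ∧ j ≤ n + k := by
  classical
  have hex : ∃ j, ∃ i P, App b ξ n i j P := by
    obtain ⟨i, j, P, h1, _⟩ := h.app n
    exact ⟨j, i, P, h1⟩
  obtain ⟨i, P, h1⟩ := Nat.find_spec hex
  obtain ⟨i2, j2, P2, h2, h3⟩ := h.app n
  have hmin : ∀ i1 j1 P1, App b ξ n i1 j1 P1 → Nat.find hex ≤ j1 :=
    fun i1 j1 P1 h => Nat.find_min' hex ⟨i1, P1, h⟩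
  exact ⟨i, Nat.find hex, P, ⟨h1, hmin⟩, (hmin _ _ _ h2).trans h3⟩

theorem qq_pos (b : ℕ) (hb : 2 ≤ b) (i j : ℕ) (hij : i < j) : 0 < qq b i j := by
  have : (b : ℤ) ^ i < (b : ℤ) ^ j := pow_lt_pow_right₀ (by exact_mod_cast (by omega : 1 < b)) hij
  unfold qq; omega

theorem qq_le (b i j : ℕ) : (qq b i j : ℝ) ≤ (b : ℝ) ^ j := by
  unfold qq; push_cast
  have : (0 : ℝ) ≤ (b : ℝ) ^ i := by positivity
  linarith

theorem qq_lt (b : ℕ) (hb : 2 ≤ b) (i1 j1 i j : ℕ) (hij : i < j) (hj : j1 < j) :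
    qq b i1 j1 < qq b i j := by
  have hb' : (2 : ℤ) ≤ b := by exact_mod_cast hb
  obtain ⟨t, rfl⟩ : ∃ t, j = t + 1 := ⟨j - 1, by omega⟩
  have h1 : (b : ℤ) ^ j1 ≤ (b : ℤ) ^ t := pow_le_pow_right₀ (by omega) (by omega)
  have h2 : (b : ℤ) ^ i ≤ (b : ℤ) ^ t := pow_le_pow_right₀ (by omega) (by omega)
  have h3 : (0 : ℤ) < (b : ℤ) ^ i1 := by positivity
  have h4 : (0 : ℤ) < (b : ℤ) ^ t := by positivity
  unfold qq
  rw [pow_succ]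
  nlinarith

theorem App.mono {b : ℕ} (hb : 2 ≤ b) {ξ : ℝ} {n m i j : ℕ} {P : ℤ} (h : App b ξ m i j P)
    (hnm : n ≤ m) : App b ξ n i j P := by
  refine ⟨h.1, lt_of_le_of_lt ?_ h.2⟩
  have hb1 : (1 : ℝ) ≤ b := by exact_mod_cast (by omega : 1 ≤ b)
  exact mul_le_mul_of_nonneg_left (pow_le_pow_right₀ hb1 hnm) (abs_nonneg _)

theorem MinApp.det_ne {b : ℕ} (hb : 2 ≤ b) {ξ : ℝ} {n n1 i j i1 j1 : ℕ} {P P1 : ℤ}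
    (h : MinApp b ξ n i j P) (h1 : App b ξ n1 i1 j1 P1) (hj : j1 < j) :
    qq b i1 j1 * P - qq b i j * P1 ≠ 0 := by
  intro hdet
  have hQ1 : 0 < qq b i1 j1 := qq_pos b hb _ _ h1.1
  have hQ : 0 < qq b i j := qq_pos b hb _ _ h.1.1
  have hlt := qq_lt b hb i1 j1 i j h.1.1 hj
  have : App b ξ n i1 j1 P1 := by
    refine ⟨h1.1, lt_of_le_of_lt ?_ h.1.2⟩
    apply mul_le_mul_of_nonneg_right _ (by positivity)
    have hQ1' : (0 : ℝ) < qq b i1 j1 := by exact_mod_cast hQ1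
    have hQ' : (0 : ℝ) < qq b i j := by exact_mod_cast hQ
    have hlt' : (qq b i1 j1 : ℝ) < qq b i j := by exact_mod_cast hlt
    have hdet' : (qq b i1 j1 : ℝ) * P - qq b i j * P1 = 0 := by exact_mod_cast hdet
    have e : (qq b i j : ℝ) * ((qq b i1 j1 : ℝ) * ξ - P1) =
        qq b i1 j1 * ((qq b i j : ℝ) * ξ - P) := by linarith
    have e2 := congrArg abs e
    rw [abs_mul, abs_mul, abs_of_pos hQ', abs_of_pos hQ1'] at e2
    have := abs_nonneg ((qq b i j : ℝ) * ξ - P)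
    by_contra hcon
    push Not at hcon
    nlinarith
  have := h.2 _ _ _ this
  omega

theorem J_large (b : ℕ) (hb : 2 ≤ b) (ξ : ℝ) (hξ : Irrational ξ) (N : ℕ) :
    ∃ n0, ∀ n, n0 ≤ n → ∀ i j P, App b ξ n i j P → N ≤ j := by
  obtain ⟨n0, h0⟩ := irr_dist b hb ξ hξ (b ^ N)
  refine ⟨n0, fun n hn i j P h => ?_⟩
  by_contra hj
  have hp := qq_pos b hb i j h.1
  have hle : qq b i j ≤ (b : ℤ) ^ N := by
    have h1 : (b : ℤ) ^ j ≤ (b : ℤ) ^ N :=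
      pow_le_pow_right₀ (by exact_mod_cast (by omega : 1 ≤ b)) (by omega)
    have h2 : (0 : ℤ) ≤ (b : ℤ) ^ i := by positivity
    unfold qq; omega
  have := h0 (qq b i j) P hp.ne' (by rw [abs_of_pos hp]; push_cast; exact hle) n hn
  linarith [h.2]

theorem qq_dvd (b i j B : ℕ) (hB : B ≤ i) (hij : i < j) : (b : ℤ) ^ B ∣ qq b i j :=
  dvd_sub (pow_dvd_pow _ (by omega)) (pow_dvd_pow _ hB)

theorem gaps (b k : ℕ) (hb : 2 ≤ b) (ξ : ℝ) (hξ : Irrational ξ) (hg : Good b k ξ) (M N0 : ℕ) :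
    ∃ n i j P, MinApp b ξ n i j P ∧ j + M ≤ n ∧ N0 ≤ j := by
  by_contra hcon
  push Not at hcon
  choose I J Pf hmin hJ using hg.minApp
  obtain ⟨n0, hn0⟩ := J_large b hb ξ hξ N0
  have hb1 : (1 : ℝ) ≤ b := by exact_mod_cast (by omega : 1 ≤ b)
  have hb2 : (2 : ℝ) ≤ b := by exact_mod_cast hb
  have hlow : ∀ n, n0 ≤ n → n < J n + M := by
    intro n hn
    by_contra hc
    have h1 := hcon n (I n) (J n) (Pf n) (hmin n) (by omega)
    have h2 := hn0 n hn _ _ _ (hmin n).1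
    omega
  set L := M + k + 1 with hL
  have hJL : ∀ n m, n0 ≤ n → n + L ≤ m → J n < J m := by
    intro n m hn hm
    have h1 := hlow m (by omega)
    have h2 := hJ n
    omega
  set B := L + k + 1 with hB
  have hI : ∀ n, n0 ≤ n → I n < B ∨ I (n + L) < B := by
    intro n hn
    by_contra hc
    push Not at hc
    have hne := (hmin (n + L)).det_ne hb (hmin n).1 (hJL n (n + L) hn le_rfl)
    set d := qq b (I n) (J n) * Pf (n + L) - qq b (I (n + L)) (J (n + L)) * Pf n with hd
    have hdv : (b : ℤ) ^ B ∣ d :=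
      dvd_sub (Dvd.dvd.mul_right (qq_dvd b _ _ _ hc.1 (hmin n).1.1) _)
        (Dvd.dvd.mul_right (qq_dvd b _ _ _ hc.2 (hmin _).1.1) _)
    have hbd := det_bound ξ (qq b (I n) (J n)) (qq b (I (n + L)) (J (n + L))) (Pf n) (Pf (n + L))
      ((b : ℝ) ^ n) ((b : ℝ) ^ (n + L)) ((b : ℝ) ^ k) ((b : ℝ) ^ (L + k))
      (qq_pos b hb _ _ (hmin n).1.1).le (qq_pos b hb _ _ (hmin _).1.1).le (by positivity)
      (by positivity) (hmin n).1.2 (hmin _).1.2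
      ((qq_le _ _ _).trans (by
        rw [← pow_add]; exact pow_le_pow_right₀ hb1 (by have := hJ n; omega)))
      ((qq_le _ _ _).trans (by
        rw [← pow_add]; exact pow_le_pow_right₀ hb1 (by have := hJ (n + L); omega)))
    rw [← hd] at hbd
    have h1 : (b : ℝ) ^ k < (b : ℝ) ^ (L + k) := pow_lt_pow_right₀ (by linarith) (by omega)
    have h2 : (b : ℝ) ^ B = (b : ℝ) ^ (L + k) * b := by rw [hB, pow_succ]
    have h3 : |(d : ℝ)| < (b : ℝ) ^ B := by
      have : (0 : ℝ) < (b : ℝ) ^ (L + k) := by positivity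
      nlinarith
    have h4 : |d| < (b : ℤ) ^ B := by exact_mod_cast h3
    exact hne (Int.eq_zero_of_abs_lt_dvd hdv h4)
  obtain ⟨n3, hn3⟩ := irr_dist b hb ξ hξ (b ^ (4 * L + B))
  set n := n0 + n3 + 4 * L + 1 with hn
  obtain ⟨n1, hn1, hn1', hI1⟩ : ∃ n1, n ≤ n1 ∧ n1 ≤ n + L ∧ I n1 < B := by
    rcases hI n (by omega) with h | h
    · exact ⟨n, le_rfl, by omega, h⟩
    · exact ⟨n + L, by omega, le_rfl, h⟩
  obtain ⟨n2, hn2, hn2', hI2⟩ : ∃ n2, n + 2 * L ≤ n2 ∧ n2 ≤ n + 3 * L ∧ I n2 < B := by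
    rcases hI (n + 2 * L) (by omega) with h | h
    · exact ⟨n + 2 * L, le_rfl, by omega, h⟩
    · exact ⟨n + 2 * L + L, by omega, by omega, h⟩
  have hJ12 := hJL n1 n2 (by omega) (by omega)
  have hne := (hmin n2).det_ne hb (hmin n1).1 hJ12
  obtain ⟨δ, hδ⟩ : ∃ δ, J n2 = J n1 + δ := ⟨J n2 - J n1, by omega⟩
  have hδL : δ ≤ 4 * L := by
    have := hJ n2
    have := hlow n1 (by omega)
    omega
  set Q1 := qq b (I n1) (J n1) with hQ1
  set Q2 := qq b (I n2) (J n2) with hQ2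
  set R := Q2 - (b : ℤ) ^ δ * Q1 with hR
  have hReq : R = (b : ℤ) ^ (δ + I n1) - (b : ℤ) ^ (I n2) := by
    rw [hR, hQ1, hQ2, hδ]; unfold qq; rw [pow_add, pow_add]; ring
  have hbz : (1 : ℤ) ≤ b := by exact_mod_cast (by omega : 1 ≤ b)
  have hRabs : |R| ≤ ((b ^ (4 * L + B) : ℕ) : ℤ) := by
    push_cast
    have h1 : (b : ℤ) ^ (δ + I n1) ≤ (b : ℤ) ^ (4 * L + B) := pow_le_pow_right₀ hbz (by omega)
    have h2 : (b : ℤ) ^ (I n2) ≤ (b : ℤ) ^ (4 * L + B) := pow_le_pow_right₀ hbz (by omega)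
    have h3 : (0 : ℤ) ≤ (b : ℤ) ^ (δ + I n1) := by positivity
    have h4 : (0 : ℤ) ≤ (b : ℤ) ^ (I n2) := by positivity
    rw [hReq, abs_le]; constructor <;> linarith
  set P' := Pf n2 - (b : ℤ) ^ δ * Pf n1 with hP'
  obtain ⟨t, ht⟩ : ∃ t, n1 = t + (4 * L + 1) := ⟨n1 - (4 * L + 1), by omega⟩
  have hsmall : |(R : ℝ) * ξ - P'| * (b : ℝ) ^ t < 1 := by
    have e1 := (hmin n1).1.2
    have e2 := ((hmin n2).1.mono hb (show n1 ≤ n2 by omega)).2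
    rw [← hQ1] at e1
    rw [← hQ2] at e2
    have h1 : (R : ℝ) * ξ - P' = ((Q2 : ℝ) * ξ - Pf n2) - (b : ℝ) ^ δ * ((Q1 : ℝ) * ξ - Pf n1) := by
      rw [hR, hP']; push_cast; ring
    have h2 : |(R : ℝ) * ξ - P'| ≤ |(Q2 : ℝ) * ξ - Pf n2|
        + (b : ℝ) ^ (4 * L) * |(Q1 : ℝ) * ξ - Pf n1| := by
      rw [h1]
      refine (abs_sub _ _).trans ?_
      rw [abs_mul, abs_of_nonneg (by positivity : (0 : ℝ) ≤ (b : ℝ) ^ δ)]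
      have : (b : ℝ) ^ δ ≤ (b : ℝ) ^ (4 * L) := pow_le_pow_right₀ hb1 hδL
      have := mul_le_mul_of_nonneg_right this (abs_nonneg ((Q1 : ℝ) * ξ - Pf n1))
      linarith
    have h3 : (1 : ℝ) ≤ (b : ℝ) ^ (4 * L) := one_le_pow₀ hb1
    have h4 : (b : ℝ) ^ n1 = (b : ℝ) ^ t * (b : ℝ) ^ (4 * L) * b := by
      rw [ht, pow_add, pow_succ]; ring
    rw [h4] at e1 e2
    have h5 : (0 : ℝ) < (b : ℝ) ^ t := by positivity
    generalize (b : ℝ) ^ t = T at *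
    generalize (b : ℝ) ^ (4 * L) = U at *
    have a1 := abs_nonneg ((Q1 : ℝ) * ξ - Pf n1)
    have a2 := abs_nonneg ((Q2 : ℝ) * ξ - Pf n2)
    generalize |(Q1 : ℝ) * ξ - Pf n1| = x1 at *
    generalize |(Q2 : ℝ) * ξ - Pf n2| = x2 at *
    have c1 : x1 * T * U * 2 < 1 := by
      have : x1 * T * U * 2 ≤ x1 * T * U * b := mul_le_mul_of_nonneg_left hb2 (by positivity)
      linarith
    have c2 : x2 * T * U * 2 < 1 := by
      have : x2 * T * U * 2 ≤ x2 * T * U * b := mul_le_mul_of_nonneg_left hb2 (by positivity)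
      linarith
    have c3 : x2 * T * 1 ≤ x2 * T * U := mul_le_mul_of_nonneg_left h3 (by positivity)
    have c4 := mul_le_mul_of_nonneg_right h2 h5.le
    linarith
  have hR0 : R = 0 := by
    by_contra hR0
    have := hn3 R P' hR0 hRabs t (by omega)
    linarith
  have hP0 : P' = 0 := by
    rw [hR0] at hsmall
    have h1 : (1 : ℝ) ≤ (b : ℝ) ^ t := one_le_pow₀ hb1
    have h2 : |(P' : ℝ)| * (b : ℝ) ^ t < 1 := by simpa using hsmall
    have h3 : |(P' : ℝ)| < 1 := by nlinarith [abs_nonneg (P' : ℝ)]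
    exact Int.abs_lt_one_iff.1 (by exact_mod_cast h3)
  apply hne
  have f1 : Q2 = (b : ℤ) ^ δ * Q1 := by linarith
  have f2 : Pf n2 = (b : ℤ) ^ δ * Pf n1 := by linarith
  rw [f1, f2]; ring

theorem gcd_bound (b k : ℕ) (hb : 2 ≤ b) (ξ : ℝ) (hg : Good b k ξ) (n i j : ℕ) (P : ℤ)
    (h : MinApp b ξ n i j P) (hjn : j ≤ n) (hkj : k + 1 ≤ j) :
    Int.gcd (qq b i j) P ≤ 1 + b ^ (k + 1) := by
  have hb1 : (1 : ℝ) ≤ b := by exact_mod_cast (by omega : 1 ≤ b)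
  obtain ⟨i1, j1, P1, h1, hj1⟩ := hg.app (j - (k + 1))
  have hne := h.det_ne hb h1 (by omega)
  have hbd := det_bound ξ (qq b i1 j1) (qq b i j) P1 P ((b : ℝ) ^ (j - (k + 1))) ((b : ℝ) ^ n)
    1 ((b : ℝ) ^ (k + 1)) (qq_pos b hb _ _ h1.1).le (qq_pos b hb _ _ h.1.1).le (by norm_num)
    (by positivity) h1.2 h.1.2
    ((qq_le _ _ _).trans (by rw [one_mul]; exact pow_le_pow_right₀ hb1 (by omega)))
    ((qq_le _ _ _).trans (by rw [← pow_add]; exact pow_le_pow_right₀ hb1 (by omega)))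
  set d := qq b i1 j1 * P - qq b i j * P1 with hd
  have hdv : (Int.gcd (qq b i j) P : ℤ) ∣ d :=
    dvd_sub (Dvd.dvd.mul_left (Int.gcd_dvd_right _ _) _)
      (Dvd.dvd.mul_right (Int.gcd_dvd_left _ _) _)
  have h2 : |d| ≤ 1 + (b : ℤ) ^ (k + 1) := by exact_mod_cast hbd
  have h3 : (Int.gcd (qq b i j) P : ℤ) ≤ |d| :=
    Int.le_of_dvd (abs_pos.2 hne) ((dvd_abs _ _).2 hdv)
  have := h3.trans h2
  exact_mod_cast this

theorem qq_nat (b : ℕ) (hb : 2 ≤ b) (i j : ℕ) (hij : i < j) :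
    ((b ^ j - b ^ i : ℕ) : ℤ) = qq b i j := by
  have : b ^ i ≤ b ^ j := Nat.pow_le_pow_right (by omega) hij.le
  unfold qq
  push_cast [this]
  rfl

theorem no_two_good (r s k : ℕ) (hr : 2 ≤ r) (hs : 2 ≤ s) (hind : MultIndep r s) (ξ : ℝ)
    (hξ : Irrational ξ) (hgr : Good r k ξ) (hgs : Good s k ξ) : False := by
  set C := 2 * s ^ (k + 1) with hC
  set G := 1 + r ^ (k + 1) with hG
  obtain ⟨N, hN⟩ := unit_eq r s (C * G) hr hs hind
  obtain ⟨n, i, j, P, hmin, hjn, hNj⟩ := gaps r k hr ξ hξ hgr (4 * C) (N + (k + 1))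
  have hgcd := gcd_bound r k hr ξ hgr n i j P hmin (by omega) (by omega)
  have hQpos := qq_pos r hr i j hmin.1.1
  have hQle := qq_le r i j
  have happ := hmin.1.2
  have hr1 : (1 : ℝ) ≤ r := by exact_mod_cast (by omega : 1 ≤ r)
  have hs1 : (1 : ℝ) ≤ s := by exact_mod_cast (by omega : 1 ≤ s)
  have hQnat := qq_nat r hr i j hmin.1.1
  set Qn := r ^ j - r ^ i with hQn
  set Q := qq r i j with hQ
  have hQn0 : 2 * Qn ≠ 0 := by omega
  obtain ⟨m, hm1, hm2⟩ : ∃ m, 2 * Qn < s ^ m ∧ s ^ m ≤ 2 * Qn * s := by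
    refine ⟨Nat.log s (2 * Qn) + 1, Nat.lt_pow_succ_log_self (by omega) _, ?_⟩
    rw [pow_succ]
    exact Nat.mul_le_mul_right _ (Nat.pow_log_le_self s hQn0)
  obtain ⟨i', j', P', hap', hj'⟩ := hgs.app m
  have hQ'pos := qq_pos s hs i' j' hap'.1
  have hQ'nat := qq_nat s hs i' j' hap'.1
  have hQ'le : s ^ j' - s ^ i' ≤ C * Qn := by
    calc s ^ j' - s ^ i' ≤ s ^ j' := Nat.sub_le _ _
      _ ≤ s ^ (m + k) := Nat.pow_le_pow_right (by omega) hj'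
      _ = s ^ m * s ^ k := pow_add _ _ _
      _ ≤ 2 * Qn * s * s ^ k := Nat.mul_le_mul_right _ hm2
      _ = C * Qn := by rw [hC, pow_succ]; ring
  set Q' := qq s i' j' with hQ'
  have hQ'leZ : Q' ≤ C * Q := by rw [← hQ'nat, ← hQnat]; exact_mod_cast hQ'le
  have hdet : Q * P' - Q' * P = 0 := by
    have hbd := det_bound ξ Q Q' P P' ((r : ℝ) ^ n) ((s : ℝ) ^ m) (1 / 2) (1 / 4) hQpos.le
      hQ'pos.le (by norm_num) (by norm_num) happ hap'.2
      (by
        have h1 : (2 : ℝ) * Qn < (s : ℝ) ^ m := by exact_mod_cast hm1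
        have h2 : (Q : ℝ) = Qn := by rw [← hQnat]; simp
        rw [h2]; linarith)
      (by
        have h1 : (Q' : ℝ) ≤ C * Q := by exact_mod_cast hQ'leZ
        have h2 : (4 * C : ℝ) ≤ (r : ℝ) ^ (4 * C) := by
          have : 4 * C ≤ r ^ (4 * C) := (Nat.lt_pow_self (by omega)).le
          exact_mod_cast this
        have h3 : (r : ℝ) ^ (4 * C) * (r : ℝ) ^ j ≤ (r : ℝ) ^ n := by
          rw [← pow_add]; exact pow_le_pow_right₀ hr1 (by omega)
        have h4 : (4 * C : ℝ) * Q ≤ (r : ℝ) ^ (4 * C) * (r : ℝ) ^ j :=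
          mul_le_mul h2 hQle (by exact_mod_cast hQpos.le) (by positivity)
        linarith)
    have h3 : |((Q * P' - Q' * P : ℤ) : ℝ)| < 1 := by linarith
    exact Int.abs_lt_one_iff.1 (by exact_mod_cast h3)
  have hg0 : 0 < Int.gcd Q P := Int.gcd_pos_of_ne_zero_left _ hQpos.ne'
  set g := Int.gcd Q P with hg
  obtain ⟨q0, hq0⟩ : (g : ℤ) ∣ Q := Int.gcd_dvd_left _ _
  obtain ⟨p0, hp0⟩ : (g : ℤ) ∣ P := Int.gcd_dvd_right _ _
  have hgz : (0 : ℤ) < g := by exact_mod_cast hg0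
  have hcop : IsCoprime q0 p0 := by
    rw [Int.isCoprime_iff_gcd_eq_one]
    have h1 : Int.gcd (g * q0) (g * p0) = g := by rw [← hq0, ← hp0]
    rw [Int.gcd_mul_left, Int.natAbs_natCast] at h1
    exact Nat.eq_of_mul_eq_mul_left hg0 (by omega)
  have hdvd : q0 ∣ Q' := by
    apply hcop.dvd_of_dvd_mul_right
    refine ⟨P', ?_⟩
    have : (g : ℤ) * (Q' * p0) = g * (q0 * P') := by
      have : (g : ℤ) * q0 * P' - Q' * (g * p0) = 0 := by rw [← hq0, ← hp0]; exact hdet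
      linarith
    exact mul_left_cancel₀ hgz.ne' this
  obtain ⟨c, hc⟩ := hdvd
  have hq0pos : 0 < q0 := by
    rw [hq0] at hQpos
    exact (mul_pos_iff_of_pos_left hgz).1 hQpos
  have hcpos : 0 < c := by
    rw [hc] at hQ'pos
    exact (mul_pos_iff_of_pos_left hq0pos).1 hQ'pos
  have hcle : c ≤ C * g := by
    have : q0 * c ≤ q0 * (C * g) := by
      rw [← hc]; rw [hq0] at hQ'leZ; linarith
    exact le_of_mul_le_mul_left this hq0pos
  lift c to ℕ using hcpos.le
  have hcn : 1 ≤ c := by exact_mod_cast hcpos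
  have hcle' : c ≤ C * g := by exact_mod_cast hcle
  have hC1 : 1 ≤ C := by
    have : 0 < s ^ (k + 1) := by positivity
    omega
  refine hN i j i' j' c g hmin.1.1 hap'.1 hcn (hcle'.trans (Nat.mul_le_mul_left _ hgcd)) hg0
    (hgcd.trans (Nat.le_mul_of_pos_left _ hC1)) ?_ (by omega)
  zify
  have e1 : ((r ^ j - r ^ i : ℕ) : ℤ) = Q := hQnat
  rw [e1, hQ'nat, hc, hq0]
  ring

theorem stmt16 (r s : ℕ) (hr : 0 < r) (hs : 0 < s) (hind : MultIndep r s)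
    (ξ : ℝ) (hξ : Irrational ξ) :
    Filter.Tendsto
      (fun n : ℕ => (wordComplexity (bdigit r ξ) n : ℤ)
        + (wordComplexity (bdigit s ξ) n : ℤ) - 2 * n)
      Filter.atTop Filter.atTop := by
  have hr2 : 2 ≤ r := by
    by_contra h
    have h1 : r = 1 := by omega
    have := (hind 1 0 (by simp [h1])).1
    omega
  have hs2 : 2 ≤ s := by
    by_contra h
    have h1 : s = 1 := by omega
    have := (hind 0 1 (by simp [h1])).2
    omega
  exact good_or_tendsto r s hr2 hs2 ξ hξ
    (fun k h1 h2 => no_two_good r s k hr2 hs2 hind ξ hξ h1 h2)
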